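/- arXiv:2012.08324 — 4 statements merged into one kernel-verified Lean document; each statement's English description precedes it below -/
import Mathlib

section
/- The product copula Π(u,v) = uv is the only idempotent 2-copula that is negative quadrant dependent. That is, if C * C = C and C(u,v) ≤ uv for all u,v ∈ [0,1], then C = Π. -/
open MeasureTheory Set Filter

def IsCopula (C : ℝ → ℝ → ℝ) : Prop :=
  (∀ u ∈ Icc (0:ℝ) 1, C u 0 = 0 ∧ C u 1 = u) ∧
  (∀ v ∈ Icc (0:ℝ) 1, C 0 v = 0 ∧ C 1 v = v) ∧
  (∀ u₁ u₂ v₁ v₂ : ℝ, u₁ ∈ Icc (0:ℝ) 1 → u₂ ∈ Icc (0:ℝ) 1 →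
    v₁ ∈ Icc (0:ℝ) 1 → v₂ ∈ Icc (0:ℝ) 1 → u₁ ≤ u₂ → v₁ ≤ v₂ →
    0 ≤ C u₂ v₂ - C u₂ v₁ - C u₁ v₂ + C u₁ v₁)

/-- Markov product of two copulas: (C₁ * C₂)(u,v) = ∫₀¹ ∂₂C₁(u,t) ∂₁C₂(t,v) dt. -/
noncomputable def MarkovProduct (C₁ C₂ : ℝ → ℝ → ℝ) (u v : ℝ) : ℝ :=
  ∫ t in (0:ℝ)..1, deriv (fun s => C₁ u s) t * deriv (fun s => C₂ s v) t

/-- Stochastically increasing in the first component: u ↦ C(u,v) is concave for each v. -/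
def StochIncr (C : ℝ → ℝ → ℝ) : Prop :=
  ∀ v ∈ Icc (0:ℝ) 1, ConcaveOn ℝ (Icc (0:ℝ) 1) (fun u => C u v)

/-- Stochastically decreasing in the first component: u ↦ C(u,v) is convex for each v. -/
def StochDecr (C : ℝ → ℝ → ℝ) : Prop :=
  ∀ v ∈ Icc (0:ℝ) 1, ConvexOn ℝ (Icc (0:ℝ) 1) (fun u => C u v)

def ML (K : ℝ) (φ : ℝ → ℝ) : Prop :=
  ∀ s ∈ Icc (0:ℝ) 1, ∀ t ∈ Icc (0:ℝ) 1, s ≤ t → 0 ≤ φ t - φ s ∧ φ t - φ s ≤ K * (t - s)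

theorem ML.lip {K : ℝ} {φ : ℝ → ℝ} (h : ML K φ) :
    LipschitzOnWith K.toNNReal φ (Icc (0:ℝ) 1) := by
  have hK : 0 ≤ K := by
    have := h 0 (by simp) 1 (by simp) zero_le_one
    linarith
  refine LipschitzOnWith.of_dist_le_mul ?_
  intro x hx y hy
  rw [Real.coe_toNNReal K hK, Real.dist_eq, Real.dist_eq]
  rcases le_total x y with hxy | hxy
  · have := h x hx y hy hxy
    rw [abs_sub_comm, abs_sub_comm x y, abs_of_nonneg this.1, abs_of_nonneg (by linarith)]
    exact this.2
  · have := h y hy x hx hxy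
    rw [abs_of_nonneg this.1, abs_of_nonneg (by linarith)]
    exact this.2

theorem ML.ac {K : ℝ} {φ : ℝ → ℝ} (h : ML K φ) {a b : ℝ} (ha : 0 ≤ a) (hab : a ≤ b) (hb : b ≤ 1) :
    AbsolutelyContinuousOnInterval φ a b := by
  apply LipschitzOnWith.absolutelyContinuousOnInterval (K := K.toNNReal)
  apply h.lip.mono
  rw [uIcc_of_le hab]
  exact Icc_subset_Icc ha hb

theorem ML.ae_diff {K : ℝ} {φ : ℝ → ℝ} (h : ML K φ) :
    ∀ᵐ t ∂(volume.restrict (Ioo (0:ℝ) 1)), DifferentiableAt ℝ φ t := by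
  rw [ae_restrict_iff' measurableSet_Ioo]
  filter_upwards [(h.ac le_rfl zero_le_one le_rfl).ae_differentiableAt] with t ht ht'
  apply ht
  rw [uIcc_of_le zero_le_one]
  exact Ioo_subset_Icc_self ht'

theorem mono_deriv {ψ : ℝ → ℝ} (h : MonotoneOn ψ (Icc (0:ℝ) 1)) {t : ℝ} (ht : t ∈ Ioo (0:ℝ) 1) :
    0 ≤ deriv ψ t := by
  rw [← derivWithin_of_mem_nhds (Icc_mem_nhds ht.1 ht.2)]
  exact h.derivWithin_nonneg

theorem ML.abs_deriv_le {K : ℝ} {φ : ℝ → ℝ} (h : ML K φ) {t : ℝ} (ht : t ∈ Ioo (0:ℝ) 1) :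
    |deriv φ t| ≤ K := by
  have hK : 0 ≤ K := by
    have := h 0 (by simp) 1 (by simp) zero_le_one
    linarith
  have := norm_deriv_le_of_lipschitzOn (Icc_mem_nhds ht.1 ht.2) h.lip
  rwa [Real.coe_toNNReal K hK, Real.norm_eq_abs] at this

theorem ML.integral {K : ℝ} {φ : ℝ → ℝ} (h : ML K φ) {b : ℝ} (h0 : 0 ≤ b) (hb : b ≤ 1) :
    ∫ t in Ioo (0:ℝ) b, deriv φ t = φ b - φ 0 := by
  rw [← integral_Ioc_eq_integral_Ioo, ← intervalIntegral.integral_of_le h0]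
  exact (h.ac le_rfl h0 hb).integral_deriv_eq_sub

theorem int_bdd {f : ℝ → ℝ} (hf : Measurable f) (B : ℝ) (hB : ∀ t ∈ Ioo (0:ℝ) 1, |f t| ≤ B) :
    Integrable f (volume.restrict (Ioo (0:ℝ) 1)) := by
  refine Integrable.of_bound hf.aestronglyMeasurable B ?_
  filter_upwards [ae_restrict_mem measurableSet_Ioo] with t ht
  exact hB t ht

theorem MeasureTheory.Integrable.isub {μ : Measure ℝ} {f g : ℝ → ℝ} (hf : Integrable f μ)
    (hg : Integrable g μ) : Integrable (fun t => f t - g t) μ := hf.sub hg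

theorem ML2 {C : ℝ → ℝ → ℝ} (hC : IsCopula C) {u : ℝ} (hu : u ∈ Icc (0:ℝ) 1) :
    ML 1 (fun s => C u s) := by
  obtain ⟨h1, h2, h3⟩ := hC
  intro s hs t ht hst
  have a := h3 0 u s t (by simp) hu hs ht hu.1 hst
  have b := h3 u 1 s t hu (by simp) hs ht hu.2 hst
  rw [(h2 s hs).1, (h2 t ht).1] at a
  rw [(h2 s hs).2, (h2 t ht).2] at b
  constructor <;> dsimp only <;> linarith

theorem ML1 {C : ℝ → ℝ → ℝ} (hC : IsCopula C) {u : ℝ} (hu : u ∈ Icc (0:ℝ) 1) :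
    ML 1 (fun s => C s u) := by
  obtain ⟨h1, h2, h3⟩ := hC
  intro s hs t ht hst
  have a := h3 s t 0 u hs ht (by simp) hu hst hu.1
  have b := h3 s t u 1 hs ht hu (by simp) hst hu.2
  rw [(h1 s hs).1, (h1 t ht).1] at a
  rw [(h1 s hs).2, (h1 t ht).2] at b
  constructor <;> dsimp only <;> linarith

theorem contraction {C : ℝ → ℝ → ℝ} (hC : IsCopula C) {v : ℝ} (hv : v ∈ Icc (0:ℝ) 1)
    {h : ℝ → ℝ} (hm : Measurable h) {B : ℝ} (hB : ∀ t ∈ Ioo (0:ℝ) 1, |h t| ≤ B)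
    (hF : ∀ u ∈ Icc (0:ℝ) 1, ∫ t in Ioo (0:ℝ) 1, deriv (fun s => C u s) t * h t = C u v) :
    ∫ t in Ioo (0:ℝ) 1, (deriv (fun s => C s v) t) ^ 2 ≤ ∫ t in Ioo (0:ℝ) 1, (h t) ^ 2 := by
  have B0 : 0 ≤ B := (abs_nonneg _).trans (hB (1/2) (by norm_num))
  have hsq : ∀ t ∈ Ioo (0:ℝ) 1, h t ^ 2 ≤ B ^ 2 := fun t ht => by
    rw [← sq_abs (h t)]
    exact pow_le_pow_left₀ (abs_nonneg _) (hB t ht) 2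
  have md : ∀ u, Measurable (deriv (fun s => C u s)) := fun u => measurable_deriv _
  have i0 : ∀ u ∈ Icc (0:ℝ) 1, Integrable (fun t => deriv (fun s => C u s) t)
      (volume.restrict (Ioo (0:ℝ) 1)) := fun u hu =>
    int_bdd (md u) 1 fun t ht => (ML2 hC hu).abs_deriv_le ht
  have i1 : ∀ u ∈ Icc (0:ℝ) 1, Integrable (fun t => deriv (fun s => C u s) t * h t)
      (volume.restrict (Ioo (0:ℝ) 1)) := fun u hu =>
    int_bdd ((md u).mul hm) (1 * B) fun t ht => by
      rw [abs_mul]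
      exact mul_le_mul ((ML2 hC hu).abs_deriv_le ht) (hB t ht) (abs_nonneg _) zero_le_one
  have i2 : ∀ u ∈ Icc (0:ℝ) 1, Integrable (fun t => deriv (fun s => C u s) t * h t ^ 2)
      (volume.restrict (Ioo (0:ℝ) 1)) := fun u hu =>
    int_bdd ((md u).mul (hm.pow_const 2)) (1 * B ^ 2) fun t ht => by
      rw [abs_mul, abs_of_nonneg (sq_nonneg (h t))]
      exact mul_le_mul ((ML2 hC hu).abs_deriv_le ht) (hsq t ht) (sq_nonneg _) zero_le_one
  have e0 : ∀ u ∈ Icc (0:ℝ) 1, ∫ t in Ioo (0:ℝ) 1, deriv (fun s => C u s) t = u := fun u hu => by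
    rw [(ML2 hC hu).integral zero_le_one le_rfl, (hC.1 u hu).1, (hC.1 u hu).2, sub_zero]
  have hw : ∀ u ∈ Icc (0:ℝ) 1, ∀ u' ∈ Icc (0:ℝ) 1, u ≤ u' →
      ∀ᵐ t ∂(volume.restrict (Ioo (0:ℝ) 1)),
        0 ≤ deriv (fun s => C u' s) t - deriv (fun s => C u s) t := by
    intro u hu u' hu' huu
    filter_upwards [(ML2 hC hu).ae_diff, (ML2 hC hu').ae_diff,
      ae_restrict_mem measurableSet_Ioo] with t d1 d2 ht
    have hmono : MonotoneOn (fun s => C u' s - C u s) (Icc (0:ℝ) 1) := by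
      intro a ha b hb hab
      have := hC.2.2 u u' a b hu hu' ha hb huu hab
      dsimp only
      linarith
    have := mono_deriv hmono ht
    rwa [deriv_fun_sub d2 d1] at this
  set F : ℝ → ℝ := fun u => ∫ t in Ioo (0:ℝ) 1, deriv (fun s => C u s) t * h t ^ 2 with hFdef
  -- monotonicity
  have hmonoF : ∀ m : ℝ, MonotoneOn (fun u => F u - 2 * m * C u v + m ^ 2 * u) (Icc (0:ℝ) 1) := by
    intro m u hu u' hu' huu
    have key : ∀ u ∈ Icc (0:ℝ) 1, F u - 2 * m * C u v + m ^ 2 * u =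
        ∫ t in Ioo (0:ℝ) 1, deriv (fun s => C u s) t * (h t - m) ^ 2 ∧
        Integrable (fun t => deriv (fun s => C u s) t * (h t - m) ^ 2)
          (volume.restrict (Ioo (0:ℝ) 1)) := by
      intro u hu
      have e : (fun t => deriv (fun s => C u s) t * (h t - m) ^ 2) = fun t =>
          deriv (fun s => C u s) t * h t ^ 2 - 2 * m * (deriv (fun s => C u s) t * h t)
            + m ^ 2 * deriv (fun s => C u s) t := by
        funext t; ring
      rw [e]
      constructor
      · rw [integral_add ((i2 u hu).isub ((i1 u hu).const_mul _)) ((i0 u hu).const_mul _),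
          integral_sub (i2 u hu) ((i1 u hu).const_mul _), integral_const_mul, integral_const_mul,
          hF u hu, e0 u hu]
      · exact ((i2 u hu).sub ((i1 u hu).const_mul _)).add ((i0 u hu).const_mul _)
    dsimp only
    rw [(key u hu).1, (key u' hu').1]
    apply integral_mono_ae (key u hu).2 (key u' hu').2
    filter_upwards [hw u hu u' hu' huu] with t ht
    exact mul_le_mul_of_nonneg_right (by linarith) (sq_nonneg _)
  have hFML : ML (B ^ 2) F := by
    intro u hu u' hu' huu
    constructor
    · have := hmonoF 0 hu hu' huu
      simp at this
      linarith
    · have : F u' - F u = ∫ t in Ioo (0:ℝ) 1,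
          (deriv (fun s => C u' s) t * h t ^ 2 - deriv (fun s => C u s) t * h t ^ 2) := by
        rw [integral_sub (i2 u' hu') (i2 u hu)]
      rw [this]
      have e : B ^ 2 * (u' - u) = ∫ t in Ioo (0:ℝ) 1,
          B ^ 2 * (deriv (fun s => C u' s) t - deriv (fun s => C u s) t) := by
        rw [integral_const_mul, integral_sub (i0 u' hu') (i0 u hu), e0 u' hu', e0 u hu]
      rw [e]
      apply integral_mono_ae ((i2 u' hu').sub (i2 u hu)) (((i0 u' hu').sub (i0 u hu)).const_mul _)
      filter_upwards [hw u hu u' hu' huu, ae_restrict_mem measurableSet_Ioo] with t ht ht'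
      have := mul_le_mul_of_nonneg_left (hsq t ht') ht
      simp only [Pi.sub_apply]
      nlinarith
  have hpt : ∀ᵐ t ∂(volume.restrict (Ioo (0:ℝ) 1)),
      (deriv (fun s => C s v) t) ^ 2 ≤ deriv F t := by
    filter_upwards [hFML.ae_diff, (ML1 hC hv).ae_diff, ae_restrict_mem measurableSet_Ioo]
      with t d1 d2 ht
    set m := deriv (fun s => C s v) t with hmdef
    have := mono_deriv (hmonoF m) ht
    have hd := ((d1.hasDerivAt.sub (d2.hasDerivAt.const_mul (2 * m))).add
      ((hasDerivAt_id t).const_mul (m ^ 2))).deriv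
    change deriv (fun u => F u - 2 * m * C u v + m ^ 2 * u) t = _ at hd
    rw [hd, ← hmdef] at this
    nlinarith
  have hint := integral_mono_ae
    (int_bdd ((measurable_deriv (fun s => C s v)).pow_const 2) 1 fun t ht => by
      have := (ML1 hC hv).abs_deriv_le ht
      rw [abs_of_nonneg (sq_nonneg _), ← sq_abs]
      exact pow_le_one₀ (abs_nonneg _) this)
    (int_bdd (measurable_deriv F) (B ^ 2) fun t ht => hFML.abs_deriv_le ht) hpt
  rw [hFML.integral zero_le_one le_rfl] at hint
  have hF1 : F 1 = ∫ t in Ioo (0:ℝ) 1, (h t) ^ 2 := by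
    apply setIntegral_congr_fun measurableSet_Ioo
    intro t ht
    have : (fun s => C 1 s) =ᶠ[nhds t] fun s => s := by
      filter_upwards [Icc_mem_nhds ht.1 ht.2] with s hs
      exact (hC.2.1 s hs).2
    simp [this.deriv_eq]
  have hF0 : F 0 = 0 := by
    have : F 0 = ∫ t in Ioo (0:ℝ) 1, (0:ℝ) := by
      apply setIntegral_congr_fun measurableSet_Ioo
      intro t ht
      have : (fun s => C 0 s) =ᶠ[nhds t] fun s => 0 := by
        filter_upwards [Icc_mem_nhds ht.1 ht.2] with s hs
        exact (hC.2.1 s hs).1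
      simp [this.deriv_eq]
    simpa using this
  rw [hF1, hF0, sub_zero] at hint
  exact hint

theorem idempotent_nqd_eq_pi (C : ℝ → ℝ → ℝ) (hC : IsCopula C)
    (hid : ∀ u ∈ Icc (0:ℝ) 1, ∀ v ∈ Icc (0:ℝ) 1, MarkovProduct C C u v = C u v)
    (hnqd : ∀ u ∈ Icc (0:ℝ) 1, ∀ v ∈ Icc (0:ℝ) 1, C u v ≤ u * v) :
    ∀ u ∈ Icc (0:ℝ) 1, ∀ v ∈ Icc (0:ℝ) 1, C u v = u * v := by
  intro u hu v hv
  set g : ℝ → ℝ := deriv (fun s => C s v) with hg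
  have gm : Measurable g := measurable_deriv _
  have gb : ∀ t ∈ Ioo (0:ℝ) 1, |g t| ≤ 1 := fun t ht => (ML1 hC hv).abs_deriv_le ht
  set χ : ℝ → ℝ := (Iio v).indicator 1 with hχ
  have χm : Measurable χ := measurable_one.indicator measurableSet_Iio
  have χb : ∀ t, |χ t| ≤ 1 := fun t => by
    by_cases ht : t < v <;> simp [hχ, Set.indicator, ht]
  have χχ : ∀ t, χ t * χ t = χ t := fun t => by
    by_cases ht : t < v <;> simp [hχ, Set.indicator, ht]
  have hχint : ∀ φ : ℝ → ℝ, ∫ t in Ioo (0:ℝ) 1, φ t * χ t = ∫ t in Ioo (0:ℝ) v, φ t := by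
    intro φ
    have : (fun t => φ t * χ t) = (Iio v).indicator φ := by
      funext t
      by_cases ht : t < v <;> simp [hχ, Set.indicator, ht]
    rw [this, setIntegral_indicator measurableSet_Iio, Ioo_inter_Iio, min_eq_right hv.2]
  have ig : Integrable g (volume.restrict (Ioo (0:ℝ) 1)) := int_bdd gm 1 gb
  have igg : Integrable (fun t => g t * g t) (volume.restrict (Ioo (0:ℝ) 1)) :=
    int_bdd (gm.mul gm) (1 * 1) fun t ht => by
      rw [abs_mul]; exact mul_le_mul (gb t ht) (gb t ht) (abs_nonneg _) zero_le_one
  have igχ : Integrable (fun t => g t * χ t) (volume.restrict (Ioo (0:ℝ) 1)) :=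
    int_bdd (gm.mul χm) (1 * 1) fun t ht => by
      rw [abs_mul]; exact mul_le_mul (gb t ht) (χb t) (abs_nonneg _) zero_le_one
  have iχ : Integrable χ (volume.restrict (Ioo (0:ℝ) 1)) := int_bdd χm 1 fun t _ => χb t
  have egχ : ∫ t in Ioo (0:ℝ) 1, g t * χ t = C v v := by
    rw [hχint, (ML1 hC hv).integral hv.1 hv.2, (hC.2.1 v hv).1, sub_zero]
  have eg : ∫ t in Ioo (0:ℝ) 1, g t = v := by
    rw [(ML1 hC hv).integral zero_le_one le_rfl, (hC.2.1 v hv).1, (hC.2.1 v hv).2, sub_zero]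
  set G := ∫ t in Ioo (0:ℝ) 1, g t * g t with hG
  set X := ∫ t in Ioo (0:ℝ) 1, χ t with hX
  have hcon : ∀ s : ℝ, G ≤ G + 2 * s * (C v v - G) + s ^ 2 * (X - 2 * C v v + G) := by
    intro s
    have := contraction hC hv (h := fun t => g t + s * (χ t - g t)) (by fun_prop)
      (B := 1 + |s| * 2) (fun t ht => by
        refine (abs_add_le _ _).trans ?_
        rw [abs_mul]
        have h1 := gb t ht
        have h2 := (abs_sub (χ t) (g t)).trans (add_le_add (χb t) h1)
        have := mul_le_mul_of_nonneg_left h2 (abs_nonneg s)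
        linarith) (fun u hu => by
        have fm : Measurable (deriv (fun s => C u s)) := measurable_deriv _
        have fb : ∀ t ∈ Ioo (0:ℝ) 1, |deriv (fun s => C u s) t| ≤ 1 :=
          fun t ht => (ML2 hC hu).abs_deriv_le ht
        have j1 : Integrable (fun t => deriv (fun s => C u s) t * g t)
            (volume.restrict (Ioo (0:ℝ) 1)) :=
          int_bdd (fm.mul gm) (1 * 1) fun t ht => by
            rw [abs_mul]; exact mul_le_mul (fb t ht) (gb t ht) (abs_nonneg _) zero_le_one
        have j2 : Integrable (fun t => deriv (fun s => C u s) t * χ t)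
            (volume.restrict (Ioo (0:ℝ) 1)) :=
          int_bdd (fm.mul χm) (1 * 1) fun t ht => by
            rw [abs_mul]; exact mul_le_mul (fb t ht) (χb t) (abs_nonneg _) zero_le_one
        have k1 : ∫ t in Ioo (0:ℝ) 1, deriv (fun s => C u s) t * g t = C u v := by
          rw [← hid u hu v hv, MarkovProduct, intervalIntegral.integral_of_le zero_le_one,
            integral_Ioc_eq_integral_Ioo]
        have k2 : ∫ t in Ioo (0:ℝ) 1, deriv (fun s => C u s) t * χ t = C u v := by
          rw [hχint, (ML2 hC hu).integral hv.1 hv.2, (hC.1 u hu).1, sub_zero]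
        have e : (fun t => deriv (fun s => C u s) t * (g t + s * (χ t - g t))) = fun t =>
            deriv (fun s => C u s) t * g t + s * (deriv (fun s => C u s) t * χ t
              - deriv (fun s => C u s) t * g t) := by
          funext t; ring
        rw [e, integral_add j1 ((j2.isub j1).const_mul s), integral_const_mul,
          integral_sub j2 j1, k1, k2]
        ring)
    have e : (fun t => (g t + s * (χ t - g t)) ^ 2) = fun t =>
        g t * g t + 2 * s * (g t * χ t - g t * g t)
          + s ^ 2 * (χ t - 2 * (g t * χ t) + g t * g t) := by
      funext t
      linear_combination s ^ 2 * χχ t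
    have e2 : ∫ t in Ioo (0:ℝ) 1, (g t) ^ 2 = G := by simp only [hG, pow_two]
    rw [e, integral_add (igg.fun_add ((igχ.isub igg).const_mul _))
        (((iχ.isub (igχ.const_mul 2)).fun_add igg).const_mul _),
      integral_add igg ((igχ.isub igg).const_mul _), integral_const_mul, integral_const_mul,
      integral_sub igχ igg, integral_add (iχ.isub (igχ.const_mul 2)) igg,
      integral_sub iχ (igχ.const_mul 2), integral_const_mul, egχ] at this
    exact e2.symm.le.trans this
  -- hence G = C v v
  have hGle : G ≤ C v v := by
    by_contra hlt
    push Not at hlt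
    set A := X - 2 * C v v + G
    set D := G - C v v
    have hD : 0 < D := by simp only [D]; linarith
    have h1 := hcon (D / (|A| + 1))
    have hp : 0 < |A| + 1 := by positivity
    have hr : 0 < D / (|A| + 1) := by positivity
    have h2 : (D / (|A| + 1)) * (|A| + 1) = D := by field_simp
    set r := D / (|A| + 1)
    have h3 : r * (r * A) ≤ r * (r * |A|) := by gcongr; exact le_abs_self A
    have h4 : r * (r * |A|) < r * (2 * D) := by
      apply mul_lt_mul_of_pos_left _ hr
      nlinarith
    simp only [D] at h4
    nlinarith
  have hz : ∫ t in Ioo (0:ℝ) 1, (g t - v) ^ 2 ≤ 0 := by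
    have e : (fun t => (g t - v) ^ 2) = fun t => g t * g t - 2 * v * g t + v ^ 2 := by
      funext t; ring
    rw [e, integral_add (igg.isub (ig.const_mul _)) (integrable_const _),
      integral_sub igg (ig.const_mul _), integral_const_mul, eg]
    have := hnqd v hv v hv
    simp
    nlinarith
  have hz0 := le_antisymm hz (integral_nonneg fun t => sq_nonneg _)
  have isq : Integrable (fun t => (g t - v) ^ 2) (volume.restrict (Ioo (0:ℝ) 1)) := by
    have e : (fun t => (g t - v) ^ 2) = fun t => g t * g t - 2 * v * g t + v ^ 2 := by
      funext t; ring
    rw [e]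
    exact (igg.sub (ig.const_mul _)).add (integrable_const _)
  rw [integral_eq_zero_iff_of_nonneg (fun t => sq_nonneg _) isq] at hz0
  have hfin : ∫ t in Ioo (0:ℝ) u, g t = ∫ t in Ioo (0:ℝ) u, v := by
    apply integral_congr_ae
    have := ae_restrict_of_ae_restrict_of_subset (Ioo_subset_Ioo_right hu.2) hz0
    filter_upwards [this] with t ht
    have : (g t - v) ^ 2 = 0 := ht
    have := pow_eq_zero_iff (two_ne_zero) |>.1 this
    linarith
  rw [(ML1 hC hv).integral hu.1 hu.2, (hC.2.1 v hv).1, sub_zero] at hfin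
  rw [hfin]
  simp [hu.1]
end

section
/- A 2-copula C is idempotent (C * C = C) and stochastically increasing (u ↦ C(u,v) concave for each v) if and only if C is an ordinal sum of copies of the product copula Π: there is a countable family of disjoint open intervals (a_k, b_k) ⊆ (0,1) such that C(u,v) = a_k + (b_k − a_k)·((u−a_k)/(b_k−a_k))·((v−a_k)/(b_k−a_k)) when (u,v) ∈ (a_k,b_k)², and C(u,v) = min(u,v) otherwise. -/
open MeasureTheory Set Filter

/-- C is an ordinal sum of copies of Π over a countable family of disjoint open
subintervals of (0,1). -/
def IsOrdinalSumOfPi (C : ℝ → ℝ → ℝ) : Prop :=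
  ∃ I : Set (ℝ × ℝ), I.Countable ∧
    (∀ p ∈ I, 0 ≤ p.1 ∧ p.1 < p.2 ∧ p.2 ≤ 1) ∧
    (I.PairwiseDisjoint fun p => Ioo p.1 p.2) ∧
    ∀ u ∈ Icc (0:ℝ) 1, ∀ v ∈ Icc (0:ℝ) 1,
      (∀ p ∈ I, u ∈ Ioo p.1 p.2 → v ∈ Ioo p.1 p.2 →
        C u v = p.1 + (p.2 - p.1) * ((u - p.1) / (p.2 - p.1)) * ((v - p.1) / (p.2 - p.1))) ∧
      ((¬ ∃ p ∈ I, u ∈ Ioo p.1 p.2 ∧ v ∈ Ioo p.1 p.2) → C u v = min u v)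


def GoodF (F : ℝ → ℝ) : Prop :=
  ∀ x ∈ Icc (0:ℝ) 1, ∀ y ∈ Icc (0:ℝ) 1, x ≤ y → F x ≤ F y ∧ F y - F x ≤ y - x

lemma GoodF.lip {F : ℝ → ℝ} (h : GoodF F) : LipschitzOnWith 1 F (Icc 0 1) := by
  apply LipschitzOnWith.of_dist_le_mul
  intro x hx y hy
  rw [Real.dist_eq, Real.dist_eq]
  rcases le_total x y with hxy | hxy
  · obtain ⟨h1, h2⟩ := h x hx y hy hxy
    rw [abs_sub_comm, abs_sub_comm x, abs_of_nonneg (by linarith), abs_of_nonneg (by linarith)]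
    simpa using h2
  · obtain ⟨h1, h2⟩ := h y hy x hx hxy
    rw [abs_of_nonneg (by linarith), abs_of_nonneg (by linarith)]
    simpa using h2

lemma GoodF.ac {F : ℝ → ℝ} (h : GoodF F) {a b : ℝ} (ha : a ∈ Icc (0:ℝ) 1)
    (hb : b ∈ Icc (0:ℝ) 1) : AbsolutelyContinuousOnInterval F a b := by
  have : LipschitzOnWith 1 F (uIcc a b) := h.lip.mono (uIcc_subset_Icc ha hb)
  exact this.absolutelyContinuousOnInterval

lemma GoodF.ftc {F : ℝ → ℝ} (h : GoodF F) {a b : ℝ} (ha : a ∈ Icc (0:ℝ) 1)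
    (hb : b ∈ Icc (0:ℝ) 1) : ∫ t in a..b, deriv F t = F b - F a :=
  (h.ac ha hb).integral_deriv_eq_sub

lemma GoodF.ii {F : ℝ → ℝ} (h : GoodF F) {a b : ℝ} (ha : a ∈ Icc (0:ℝ) 1)
    (hb : b ∈ Icc (0:ℝ) 1) : IntervalIntegrable (deriv F) volume a b :=
  (h.ac ha hb).intervalIntegrable_deriv

lemma GoodF.deriv_mem {F : ℝ → ℝ} (h : GoodF F) {t : ℝ} (ht : t ∈ Ioo (0:ℝ) 1) :
    0 ≤ deriv F t ∧ deriv F t ≤ 1 := by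
  have hn : Icc (0:ℝ) 1 ∈ nhds t := Icc_mem_nhds ht.1 ht.2
  constructor
  · rw [← derivWithin_of_mem_nhds hn]
    exact MonotoneOn.derivWithin_nonneg (fun x hx y hy hxy => (h x hx y hy hxy).1)
  · have := norm_deriv_le_of_lipschitzOn hn h.lip
    rw [Real.norm_eq_abs] at this
    exact (le_abs_self _).trans (by simpa using this)

lemma GoodF.ae_diff {F : ℝ → ℝ} (h : GoodF F) :
    ∀ᵐ t, t ∈ Ioo (0:ℝ) 1 → DifferentiableAt ℝ F t := by
  filter_upwards [h.lip.ae_differentiableWithinAt_of_mem] with t ht htm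
  exact (ht (Ioo_subset_Icc_self htm)).differentiableAt (Icc_mem_nhds htm.1 htm.2)

lemma GoodF.ii_mul {F K : ℝ → ℝ} (hF : GoodF F) (hK : GoodF K) {a b : ℝ} (ha : a ∈ Icc (0:ℝ) 1)
    (hb : b ∈ Icc (0:ℝ) 1) (hab : a ≤ b) :
    IntervalIntegrable (fun t => deriv K t * deriv F t) volume a b := by
  rw [intervalIntegrable_iff_integrableOn_Ioo_of_le hab]
  refine Integrable.bdd_mul (c := 1) ?_ (measurable_deriv K).aestronglyMeasurable ?_
  · exact (intervalIntegrable_iff_integrableOn_Ioo_of_le hab).1 (hF.ii ha hb)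
  · filter_upwards [ae_restrict_mem measurableSet_Ioo] with t ht
    have := hK.deriv_mem (t := t) ⟨ha.1.trans_lt ht.1, ht.2.trans_le hb.2⟩
    rw [Real.norm_eq_abs, abs_le]; constructor <;> linarith

/-- supergradient -/
lemma concave_supergrad {F : ℝ → ℝ} (hc : ConcaveOn ℝ (Icc (0:ℝ) 1) F) {u : ℝ}
    (hu : u ∈ Ioo (0:ℝ) 1) : ∃ c, ∀ s ∈ Icc (0:ℝ) 1, F s ≤ F u + c * (s - u) := by
  have hi : u ∈ interior (Icc (0:ℝ) 1) := by rwa [interior_Icc]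
  have hn := hc.neg
  have huc := Ioo_subset_Icc_self hu
  refine ⟨- derivWithin (-F) (Ioi u) u, fun s hs => ?_⟩
  rcases lt_trichotomy s u with h | h | h
  · have h1 := hn.slope_le_leftDeriv_of_mem_interior hs hi h
    have h2 := hn.leftDeriv_le_rightDeriv_of_mem_interior hi
    have h3 := h1.trans h2
    rw [slope_def_field, div_le_iff₀ (by linarith)] at h3
    simp only [Pi.neg_apply] at h3
    linarith
  · subst h; simp
  · have h3 := hn.rightDeriv_le_slope_of_mem_interior hi hs h
    rw [slope_def_field, le_div_iff₀ (by linarith)] at h3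
    simp only [Pi.neg_apply] at h3
    linarith

lemma concave_tangent {F : ℝ → ℝ} (hc : ConcaveOn ℝ (Icc (0:ℝ) 1) F) {t : ℝ}
    (ht : t ∈ Ioo (0:ℝ) 1) (hd : DifferentiableAt ℝ F t) :
    ∀ s ∈ Icc (0:ℝ) 1, F s ≤ F t + deriv F t * (s - t) := by
  intro s hs
  have htc := Ioo_subset_Icc_self ht
  rcases lt_trichotomy s t with h | h | h
  · have h3 := hc.deriv_le_slope hs htc h hd
    rw [slope_def_field, le_div_iff₀ (by linarith)] at h3
    linarith
  · subst h; simp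
  · have h3 := hc.slope_le_deriv htc hs h hd
    rw [slope_def_field, div_le_iff₀ (by linarith)] at h3
    linarith

lemma core {F K : ℝ → ℝ} (hF : GoodF F) (hK : GoodF K) (hc : ConcaveOn ℝ (Icc (0:ℝ) 1) F)
    {u : ℝ} (hu : u ∈ Ioo (0:ℝ) 1) (hF0 : F 0 = 0) (hK0 : K 0 = 0) (hK1 : K 1 = u)
    (hint : ∫ t in (0:ℝ)..1, deriv K t * deriv F t = F u) (hKu : K u ≠ u) :
    ∃ t t' c, 0 < t ∧ t < u ∧ u < t' ∧ t' < 1 ∧ ∀ s ∈ Icc t t', F s = F t + c * (s - t) := by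
  obtain ⟨c, hcs⟩ := concave_supergrad hc hu
  have h0 : (0:ℝ) ∈ Icc (0:ℝ) 1 := by simp
  have h1 : (1:ℝ) ∈ Icc (0:ℝ) 1 := by simp
  have huc := Ioo_subset_Icc_self hu
  have hleft : ∀ t ∈ Ioo (0:ℝ) u, DifferentiableAt ℝ F t → c ≤ deriv F t := by
    intro t ht hd
    have a := concave_tangent hc ⟨ht.1, ht.2.trans hu.2⟩ hd u huc
    have b := hcs t ⟨ht.1.le, (ht.2.trans hu.2).le⟩
    have : 0 < u - t := by linarith [ht.2]
    nlinarith
  have hright : ∀ t ∈ Ioo u 1, DifferentiableAt ℝ F t → deriv F t ≤ c := by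
    intro t ht hd
    have a := concave_tangent hc ⟨hu.1.trans ht.1, ht.2⟩ hd u huc
    have b := hcs t ⟨(hu.1.trans ht.1).le, ht.2.le⟩
    have : 0 < t - u := by linarith [ht.1]
    nlinarith
  have iK1 := hK.ii h0 huc
  have iK2 := hK.ii huc h1
  have iF1 := hF.ii h0 huc
  have iF2 := hF.ii huc h1
  have iM1 := hF.ii_mul hK h0 huc hu.1.le
  have iM2 := hF.ii_mul hK huc h1 hu.2.le
  have eK1 := hK.ftc h0 huc
  have eK2 := hK.ftc huc h1
  have eF1 := hF.ftc h0 huc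
  set A : ℝ → ℝ := fun t => (1 - deriv K t) * (deriv F t - c) with hA
  set B : ℝ → ℝ := fun t => deriv K t * (c - deriv F t) with hB
  have hAe : A = fun t => (deriv F t - c) - (deriv K t * deriv F t - c * deriv K t) := by
    funext t; simp only [hA]; ring
  have hBe : B = fun t => c * deriv K t - deriv K t * deriv F t := by
    funext t; simp only [hB]; ring
  have iA : IntervalIntegrable A volume 0 u := by
    rw [hAe]
    exact (iF1.sub intervalIntegrable_const).sub (iM1.sub (iK1.const_mul c))
  have iB : IntervalIntegrable B volume u 1 := by
    rw [hBe]
    exact (iK2.const_mul c).sub iM2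
  have sA : ∫ t in (0:ℝ)..u, A t = F u - c * u - ((∫ t in (0:ℝ)..u, deriv K t * deriv F t) - c * K u) := by
    rw [hAe, intervalIntegral.integral_sub (iF1.sub intervalIntegrable_const)
      (iM1.sub (iK1.const_mul c)), intervalIntegral.integral_sub iF1 intervalIntegrable_const,
      intervalIntegral.integral_sub iM1 (iK1.const_mul c), intervalIntegral.integral_const_mul,
      eK1, eF1, intervalIntegral.integral_const, hF0, hK0]
    simp only [smul_eq_mul]; ring
  have sB : ∫ t in u..1, B t = c * (u - K u) - ∫ t in u..1, deriv K t * deriv F t := by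
    rw [hBe, intervalIntegral.integral_sub (iK2.const_mul c) iM2,
      intervalIntegral.integral_const_mul, eK2, hK1]
  have hsum := intervalIntegral.integral_add_adjacent_intervals iM1 iM2
  have hdiff := hF.ae_diff
  have nA : ∀ᵐ t ∂(volume.restrict (Ioo 0 u)), 0 ≤ A t := by
    rw [ae_restrict_iff' measurableSet_Ioo]
    filter_upwards [hdiff] with t ht htm
    have htm' : t ∈ Ioo (0:ℝ) 1 := ⟨htm.1, htm.2.trans hu.2⟩
    exact mul_nonneg (by linarith [(hK.deriv_mem htm').2]) (by linarith [hleft t htm (ht htm')])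
  have nB : ∀ᵐ t ∂(volume.restrict (Ioo u 1)), 0 ≤ B t := by
    rw [ae_restrict_iff' measurableSet_Ioo]
    filter_upwards [hdiff] with t ht htm
    have htm' : t ∈ Ioo (0:ℝ) 1 := ⟨hu.1.trans htm.1, htm.2⟩
    exact mul_nonneg (by linarith [(hK.deriv_mem htm').1]) (by linarith [hright t htm (ht htm')])
  rw [intervalIntegral.integral_of_le hu.1.le, integral_Ioc_eq_integral_Ioo] at sA
  rw [intervalIntegral.integral_of_le hu.2.le, integral_Ioc_eq_integral_Ioo] at sB
  have pA := integral_nonneg_of_ae nA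
  have pB := integral_nonneg_of_ae nB
  have zA : ∫ t in Ioo 0 u, A t = 0 := by linarith
  have zB : ∫ t in Ioo u 1, B t = 0 := by linarith
  rw [intervalIntegrable_iff_integrableOn_Ioo_of_le hu.1.le] at iA
  rw [intervalIntegrable_iff_integrableOn_Ioo_of_le hu.2.le] at iB
  rw [integral_eq_zero_iff_of_nonneg_ae nA iA] at zA
  rw [integral_eq_zero_iff_of_nonneg_ae nB iB] at zB
  have exl : ∃ t ∈ Ioo (0:ℝ) u, DifferentiableAt ℝ F t ∧ deriv F t = c := by
    by_contra! hne
    apply hKu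
    have : ∫ t in (0:ℝ)..u, deriv K t = ∫ t in (0:ℝ)..u, (1:ℝ) := by
      rw [intervalIntegral.integral_of_le hu.1.le, integral_Ioc_eq_integral_Ioo,
        intervalIntegral.integral_of_le hu.1.le, integral_Ioc_eq_integral_Ioo]
      apply integral_congr_ae
      filter_upwards [zA, ae_restrict_mem measurableSet_Ioo, ae_restrict_of_ae hdiff] with t hz ht hd
      have h3 := hne t ht (hd ⟨ht.1, ht.2.trans hu.2⟩)
      have h4 : (1 - deriv K t) * (deriv F t - c) = 0 := hz
      rcases mul_eq_zero.1 h4 with h5 | h5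
      · linarith
      · exact absurd (by linarith) h3
    rw [eK1, hK0, intervalIntegral.integral_const] at this
    simpa using this
  have exr : ∃ t ∈ Ioo u (1:ℝ), DifferentiableAt ℝ F t ∧ deriv F t = c := by
    by_contra! hne
    apply hKu
    have : ∫ t in u..1, deriv K t = ∫ t in u..1, (0:ℝ) := by
      rw [intervalIntegral.integral_of_le hu.2.le, integral_Ioc_eq_integral_Ioo,
        intervalIntegral.integral_of_le hu.2.le, integral_Ioc_eq_integral_Ioo]
      apply integral_congr_ae
      filter_upwards [zB, ae_restrict_mem measurableSet_Ioo, ae_restrict_of_ae hdiff] with t hz ht hd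
      have h3 := hne t ht (hd ⟨hu.1.trans ht.1, ht.2⟩)
      have h4 : deriv K t * (c - deriv F t) = 0 := hz
      rcases mul_eq_zero.1 h4 with h5 | h5
      · exact h5
      · exact absurd (by linarith) h3
    rw [eK2, hK1, intervalIntegral.integral_const] at this
    simp only [smul_eq_mul, mul_zero] at this
    linarith
  obtain ⟨t, ht, hdt, hct⟩ := exl
  obtain ⟨t', ht', hdt', hct'⟩ := exr
  have htm : t ∈ Ioo (0:ℝ) 1 := ⟨ht.1, ht.2.trans hu.2⟩
  have htm' : t' ∈ Ioo (0:ℝ) 1 := ⟨hu.1.trans ht'.1, ht'.2⟩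
  have T := concave_tangent hc htm hdt
  have T' := concave_tangent hc htm' hdt'
  rw [hct] at T
  rw [hct'] at T'
  refine ⟨t, t', c, ht.1, ht.2, ht'.1, ht'.2, fun s hs => ?_⟩
  have hsm : s ∈ Icc (0:ℝ) 1 := ⟨htm.1.le.trans hs.1, hs.2.trans htm'.2.le⟩
  have e1 := T s hsm
  have e2 := T t' (Ioo_subset_Icc_self htm')
  have e3 := T' t (Ioo_subset_Icc_self htm)
  have hlt : 0 < t' - t := by linarith [ht.2, ht'.1]
  have w1 : 0 ≤ (t' - s) / (t' - t) := div_nonneg (by linarith [hs.2]) hlt.le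
  have w2 : 0 ≤ (s - t) / (t' - t) := div_nonneg (by linarith [hs.1]) hlt.le
  have e4 := hc.2 (Ioo_subset_Icc_self htm) (Ioo_subset_Icc_self htm') w1 w2
    (by field_simp; ring)
  have e5 : ((t' - s) / (t' - t)) • t + ((s - t) / (t' - t)) • t' = s := by
    simp only [smul_eq_mul]; field_simp; ring
  rw [e5] at e4
  have e6 : F t' = F t + c * (t' - t) := by linarith
  rw [e6] at e4
  have e7 : ((t' - s) / (t' - t)) • F t + ((s - t) / (t' - t)) • (F t + c * (t' - t))
      = F t + c * (s - t) := by
    simp only [smul_eq_mul]; field_simp; ring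
  rw [e7] at e4
  linarith

/-- locally affine on an interval implies affine -/
lemma affine_of_local {F : ℝ → ℝ} (hF : GoodF F) {a b : ℝ} (ha : 0 ≤ a) (hab : a < b) (hb : b ≤ 1)
    (h : ∀ u ∈ Ioo a b, ∃ t t' c, 0 < t ∧ t < u ∧ u < t' ∧ t' < 1 ∧
      ∀ s ∈ Icc t t', F s = F t + c * (s - t)) :
    ∀ u ∈ Icc a b, F u = F a + (F b - F a) / (b - a) * (u - a) := by
  have key : ∀ u ∈ Ioo a b, ∃ c, deriv F =ᶠ[nhds u] fun _ => c := by
    intro u hu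
    obtain ⟨t, t', c, h0, h1, h2, h3, h4⟩ := h u hu
    refine ⟨c, ?_⟩
    have : F =ᶠ[nhds u] fun s => F t + c * (s - t) := by
      filter_upwards [Icc_mem_nhds h1 h2] with s hs using h4 s hs
    refine this.deriv.trans (Eventually.of_forall fun s => ?_)
    have hd : HasDerivAt (fun s => F t + c * (s - t)) (c * 1) s :=
      (((hasDerivAt_id s).sub_const t).const_mul c).const_add (F t)
    simp
  obtain ⟨d, hd⟩ := isOpen_Ioo.exists_is_const_of_deriv_eq_zero (s := Ioo a b) (f := deriv F)
    isPreconnected_Ioo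
    (fun u hu => by
      obtain ⟨c, hc⟩ := key u hu
      exact (hc.differentiableAt_iff.2 (differentiableAt_const c)).differentiableWithinAt)
    (fun u hu => by
      obtain ⟨c, hc⟩ := key u hu
      simpa using hc.deriv_eq)
  have lin : ∀ u ∈ Icc a b, F u - F a = d * (u - a) := by
    intro u hu
    rw [← hF.ftc ⟨ha, hab.le.trans hb⟩ ⟨ha.trans hu.1, hu.2.trans hb⟩,
      intervalIntegral.integral_of_le hu.1, integral_Ioc_eq_integral_Ioo,
      setIntegral_congr_fun measurableSet_Ioo (g := fun _ => d)
        (fun x hx => hd x ⟨hx.1, hx.2.trans_le hu.2⟩),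
      ← integral_Ioc_eq_integral_Ioo, ← intervalIntegral.integral_of_le hu.1,
      intervalIntegral.integral_const, smul_eq_mul, mul_comm]
  intro u hu
  have hba : 0 < b - a := by linarith
  rw [lin b ⟨hab.le, le_rfl⟩, mul_div_assoc, div_self hba.ne', mul_one, ← lin u hu]
  ring

lemma IsCopula.good1 {C : ℝ → ℝ → ℝ} (hC : IsCopula C) {v : ℝ} (hv : v ∈ Icc (0:ℝ) 1) :
    GoodF (fun s => C s v) := by
  obtain ⟨h1, h2, h3⟩ := hC
  intro x hx y hy hxy
  have a := h3 x y 0 v hx hy (by simp) hv hxy hv.1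
  have b := h3 x y v 1 hx hy hv (by simp) hxy hv.2
  have := h1 x hx
  have := h1 y hy
  simp only
  constructor <;> linarith

lemma IsCopula.good2 {C : ℝ → ℝ → ℝ} (hC : IsCopula C) {v : ℝ} (hv : v ∈ Icc (0:ℝ) 1) :
    GoodF (fun s => C v s) := by
  obtain ⟨h1, h2, h3⟩ := hC
  intro x hx y hy hxy
  have a := h3 0 v x y (by simp) hv hx hy hv.1 hxy
  have b := h3 v 1 x y hv (by simp) hx hy hv.2 hxy
  have := h2 x hx
  have := h2 y hy
  simp only
  constructor <;> linarith

lemma IsCopula.le_min {C : ℝ → ℝ → ℝ} (hC : IsCopula C) {u v : ℝ} (hu : u ∈ Icc (0:ℝ) 1)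
    (hv : v ∈ Icc (0:ℝ) 1) : C u v ≤ min u v := by
  have a := (hC.good1 hv u hu 1 (by simp) hu.2).1
  have b := (hC.good2 hu v hv 1 (by simp) hv.2).1
  simp only [(hC.1 u hu).2] at b
  simp only [(hC.2.1 v hv).2] at a
  exact _root_.le_min b a

lemma IsCopula.eq_min_of_fix {C : ℝ → ℝ → ℝ} (hC : IsCopula C) {u v w : ℝ}
    (hu : u ∈ Icc (0:ℝ) 1) (hv : v ∈ Icc (0:ℝ) 1) (hw : w ∈ Icc (0:ℝ) 1) (hww : C w w = w)
    (h : (u ≤ w ∧ w ≤ v) ∨ (v ≤ w ∧ w ≤ u)) : C u v = min u v := by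
  apply le_antisymm (hC.le_min hu hv)
  rcases h with ⟨h1, h2⟩ | ⟨h1, h2⟩
  · have a := (hC.good1 hw u hu w hw h1).2
    have b := (hC.good2 hu w hw v hv h2).1
    simp only at a b
    exact (min_le_left _ _).trans (by linarith)
  · have a := (hC.good2 hw v hv w hw h1).2
    have b := (hC.good1 hv w hw u hu h2).1
    simp only at a b
    exact (min_le_right _ _).trans (by linarith)

lemma IsCopula.diag_cont {C : ℝ → ℝ → ℝ} (hC : IsCopula C) :
    ContinuousOn (fun w => C w w) (Icc 0 1) := by
  apply LipschitzOnWith.continuousOn (K := 2)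
  apply LipschitzOnWith.of_dist_le_mul
  have key : ∀ x ∈ Icc (0:ℝ) 1, ∀ y ∈ Icc (0:ℝ) 1, x ≤ y →
      0 ≤ C y y - C x x ∧ C y y - C x x ≤ 2 * (y - x) := by
    intro x hx y hy hxy
    have a := hC.good1 hx x hx y hy hxy
    have b := hC.good2 hy x hx y hy hxy
    simp only at a b
    constructor <;> linarith [a.1, a.2, b.1, b.2]
  intro x hx y hy
  rw [Real.dist_eq, Real.dist_eq]
  rcases le_total x y with hxy | hxy
  · obtain ⟨h1, h2⟩ := key x hx y hy hxy
    rw [abs_sub_comm, abs_sub_comm x, abs_of_nonneg h1, abs_of_nonneg (by linarith)]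
    simpa using h2
  · obtain ⟨h1, h2⟩ := key y hy x hx hxy
    rw [abs_of_nonneg h1, abs_of_nonneg (by linarith)]
    simpa using h2

/-- The interval of the complement of the fixed points. -/
lemma IsCopula.exists_gap {C : ℝ → ℝ → ℝ} (hC : IsCopula C) {x y : ℝ} (hx : 0 ≤ x) (hxy : x ≤ y)
    (hy : y ≤ 1) (h : ∀ w ∈ Icc x y, C w w ≠ w) :
    ∃ a b, 0 ≤ a ∧ a < x ∧ y < b ∧ b ≤ 1 ∧ C a a = a ∧ C b b = b ∧ ∀ w ∈ Ioo a b, C w w ≠ w := by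
  have hcl : IsClosed {w ∈ Icc (0:ℝ) 1 | C w w = w} :=
    isClosed_Icc.isClosed_eq hC.diag_cont continuousOn_id
  set W := {w ∈ Icc (0:ℝ) 1 | C w w = w} with hW
  have W0 : (0:ℝ) ∈ W := ⟨by simp, (hC.1 0 (by simp)).1⟩
  have W1 : (1:ℝ) ∈ W := ⟨by simp, (hC.1 1 (by simp)).2⟩
  have cA : IsCompact (W ∩ Icc 0 x) := isCompact_Icc.inter_left hcl
  have cB : IsCompact (W ∩ Icc y 1) := isCompact_Icc.inter_left hcl
  obtain ⟨a, ⟨haW, ha⟩, hamax⟩ := cA.exists_isGreatest ⟨0, W0, le_rfl, hx⟩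
  obtain ⟨b, ⟨hbW, hb⟩, hbmin⟩ := cB.exists_isLeast ⟨1, W1, hy, le_rfl⟩
  refine ⟨a, b, ha.1, ?_, ?_, hb.2, haW.2, hbW.2, ?_⟩
  · exact lt_of_le_of_ne ha.2 fun e => h x ⟨le_rfl, hxy⟩ (e ▸ haW.2)
  · exact lt_of_le_of_ne hb.1 fun e => h y ⟨hxy, le_rfl⟩ (e ▸ hbW.2)
  · intro w hw hww
    have hwW : w ∈ W := ⟨⟨ha.1.trans hw.1.le, hw.2.le.trans hb.2⟩, hww⟩
    rcases le_or_gt w x with h1 | h1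
    · exact absurd (hamax ⟨hwW, hwW.1.1, h1⟩) (not_le.2 hw.1)
    · rcases le_or_gt y w with h2 | h2
      · exact absurd (hbmin ⟨hwW, h2, hwW.1.2⟩) (not_le.2 hw.2)
      · exact h w ⟨h1.le, h2.le⟩ hww

lemma forward_dir {C : ℝ → ℝ → ℝ} (hC : IsCopula C)
    (hid : ∀ u ∈ Icc (0:ℝ) 1, ∀ v ∈ Icc (0:ℝ) 1, MarkovProduct C C u v = C u v)
    (hs : StochIncr C) : IsOrdinalSumOfPi C := by
  set I : Set (ℝ × ℝ) := {p | 0 ≤ p.1 ∧ p.1 < p.2 ∧ p.2 ≤ 1 ∧ C p.1 p.1 = p.1 ∧ C p.2 p.2 = p.2 ∧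
    ∀ w ∈ Ioo p.1 p.2, C w w ≠ w} with hI
  have hdisj : I.PairwiseDisjoint fun p => Ioo p.1 p.2 := by
    intro p hp q hq hpq
    rw [Function.onFun, Set.disjoint_left]
    intro z hz hz'
    apply hpq
    obtain ⟨p1, p2, p3, p4, p5, p6⟩ := hp
    obtain ⟨q1, q2, q3, q4, q5, q6⟩ := hq
    have e1 : p.1 = q.1 := by
      rcases lt_trichotomy p.1 q.1 with h | h | h
      · exact absurd q4 (p6 _ ⟨h, hz'.1.trans hz.2⟩)
      · exact h
      · exact absurd p4 (q6 _ ⟨h, hz.1.trans hz'.2⟩)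
    have e2 : p.2 = q.2 := by
      rcases lt_trichotomy p.2 q.2 with h | h | h
      · exact absurd p5 (q6 _ ⟨hz'.1.trans hz.2, h⟩)
      · exact h
      · exact absurd q5 (p6 _ ⟨hz.1.trans hz'.2, h⟩)
    exact Prod.ext e1 e2
  refine ⟨I, ?_, fun p hp => ⟨hp.1, hp.2.1, hp.2.2.1⟩, hdisj, ?_⟩
  · exact hdisj.countable_of_isOpen (fun _ _ => isOpen_Ioo) (fun p hp => nonempty_Ioo.2 hp.2.1)
  intro u hu v hv
  constructor
  · rintro ⟨a, b⟩ ⟨h1, h2, h3, h4, h5, h6⟩ hua hva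
    simp only at h1 h2 h3 h4 h5 h6 hua hva ⊢
    have ha : a ∈ Icc (0:ℝ) 1 := ⟨h1, h2.le.trans h3⟩
    have hb : b ∈ Icc (0:ℝ) 1 := ⟨h1.trans h2.le, h3⟩
    have := affine_of_local (hC.good1 hv) h1 h2 h3 (fun w hw => by
      have hw' : w ∈ Ioo (0:ℝ) 1 := ⟨h1.trans_lt hw.1, hw.2.trans_le h3⟩
      have hwc := Ioo_subset_Icc_self hw'
      exact core (hC.good1 hv) (hC.good2 hwc) (hs v hv) hw' (hC.2.1 v hv).1 (hC.1 w hwc).1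
        (hC.1 w hwc).2 (hid w hwc v hv) (h6 w hw)) u ⟨hua.1.le, hua.2.le⟩
    rw [this, hC.eq_min_of_fix ha hv ha h4 (Or.inl ⟨le_rfl, hva.1.le⟩),
      hC.eq_min_of_fix hb hv hb h5 (Or.inr ⟨hva.2.le, le_rfl⟩), min_eq_left hva.1.le,
      min_eq_right hva.2.le]
    have : b - a ≠ 0 := by linarith
    field_simp
  · intro hno
    by_contra hne
    rcases le_total u v with huv | huv
    · obtain ⟨a, b, h1, h2, h3, h4, h5, h6, h7⟩ := hC.exists_gap hu.1 huv hv.2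
        (fun w hw hww => hne (hC.eq_min_of_fix hu hv ⟨hu.1.trans hw.1, hw.2.trans hv.2⟩ hww
          (Or.inl hw)))
      exact hno ⟨(a, b), ⟨h1, h2.trans_le (huv.trans h3.le), h4, h5, h6, h7⟩,
        ⟨h2, huv.trans_lt h3⟩, ⟨h2.trans_le huv, h3⟩⟩
    · obtain ⟨a, b, h1, h2, h3, h4, h5, h6, h7⟩ := hC.exists_gap hv.1 huv hu.2
        (fun w hw hww => hne (hC.eq_min_of_fix hu hv ⟨hv.1.trans hw.1, hw.2.trans hu.2⟩ hww
          (Or.inr hw)))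
      exact hno ⟨(a, b), ⟨h1, h2.trans_le (huv.trans h3.le), h4, h5, h6, h7⟩,
        ⟨h2.trans_le huv, h3⟩, ⟨h2, huv.trans_lt h3⟩⟩

/-- Markov product against a piecewise-affine section. -/
lemma markov_pw {C : ℝ → ℝ → ℝ} (hC : IsCopula C) {u v a b s : ℝ} (hu : u ∈ Icc (0:ℝ) 1)
    (ha : 0 ≤ a) (hab : a ≤ b) (hb : b ≤ 1)
    (h1 : ∀ t ∈ Ioo 0 a, C t v = t) (h2 : ∀ t ∈ Ioo a b, C t v = a + s * (t - a))
    (h3 : ∀ t ∈ Ioo b 1, C t v = v) :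
    MarkovProduct C C u v = C u a + s * (C u b - C u a) := by
  have hK := hC.good2 hu
  have m0 : (0:ℝ) ∈ Icc (0:ℝ) 1 := by simp
  have m1 : (1:ℝ) ∈ Icc (0:ℝ) 1 := by simp
  have ma : a ∈ Icc (0:ℝ) 1 := ⟨ha, hab.trans hb⟩
  have mb : b ∈ Icc (0:ℝ) 1 := ⟨ha.trans hab, hb⟩
  have seg : ∀ x ∈ Icc (0:ℝ) 1, ∀ y ∈ Icc (0:ℝ) 1, x ≤ y → ∀ k m : ℝ,
      (∀ t ∈ Ioo x y, C t v = m + k * t) →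
      IntervalIntegrable (fun t => deriv (fun s => C u s) t * deriv (fun s => C s v) t) volume x y ∧
      ∫ t in x..y, deriv (fun s => C u s) t * deriv (fun s => C s v) t = k * (C u y - C u x) := by
    intro x hx y hy hxy k m h
    have hd : ∀ t ∈ Ioo x y, deriv (fun s => C u s) t * deriv (fun s => C s v) t
        = k * deriv (fun s => C u s) t := by
      intro t ht
      have e : (fun s => C s v) =ᶠ[nhds t] fun s => m + k * s := by
        filter_upwards [Ioo_mem_nhds ht.1 ht.2] with r hr using h r hr
      have hd : HasDerivAt (fun s => m + k * s) (k * 1) t :=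
        ((hasDerivAt_id t).const_mul k).const_add m
      rw [e.deriv_eq, hd.deriv]; ring
    have i0 := (hK.ii hx hy).const_mul k
    constructor
    · rw [intervalIntegrable_iff_integrableOn_Ioo_of_le hxy] at i0 ⊢
      exact i0.congr_fun (fun t ht => (hd t ht).symm) measurableSet_Ioo
    · rw [intervalIntegral.integral_of_le hxy, integral_Ioc_eq_integral_Ioo,
        setIntegral_congr_fun measurableSet_Ioo hd, ← integral_Ioc_eq_integral_Ioo,
        ← intervalIntegral.integral_of_le hxy, intervalIntegral.integral_const_mul, hK.ftc hx hy]
  obtain ⟨i1, e1⟩ := seg 0 m0 a ma ha 1 0 (fun t ht => by rw [h1 t ht]; ring)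
  obtain ⟨i2, e2⟩ := seg a ma b mb hab s (a - s * a) (fun t ht => by rw [h2 t ht]; ring)
  obtain ⟨i3, e3⟩ := seg b mb 1 m1 hb 0 v (fun t ht => by rw [h3 t ht]; ring)
  unfold MarkovProduct
  rw [← intervalIntegral.integral_add_adjacent_intervals (i1.trans i2) i3,
    ← intervalIntegral.integral_add_adjacent_intervals i1 i2, e1, e2, e3, (hC.1 u hu).1]
  ring

lemma backward_dir {C : ℝ → ℝ → ℝ} (hC : IsCopula C) (h : IsOrdinalSumOfPi C) :
    (∀ u ∈ Icc (0:ℝ) 1, ∀ v ∈ Icc (0:ℝ) 1, MarkovProduct C C u v = C u v) ∧ StochIncr C := by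
  obtain ⟨I, -, hI, hdisj, hform⟩ := h
  have fixl : ∀ p ∈ I, C p.1 p.1 = p.1 := by
    intro p hp
    obtain ⟨p1, p2, p3⟩ := hI p hp
    have hm : p.1 ∈ Icc (0:ℝ) 1 := ⟨p1, p2.le.trans p3⟩
    rw [(hform _ hm _ hm).2, min_self]
    rintro ⟨q, hq, hpq, -⟩
    have hne : p ≠ q := by rintro rfl; exact lt_irrefl _ hpq.1
    obtain ⟨z, hz1, hz2⟩ := exists_between (lt_min p2 hpq.2)
    exact Set.disjoint_left.1 (hdisj hp hq hne) ⟨hz1, hz2.trans_le (min_le_left _ _)⟩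
      ⟨hpq.1.trans hz1, hz2.trans_le (min_le_right _ _)⟩
  have fixr : ∀ p ∈ I, C p.2 p.2 = p.2 := by
    intro p hp
    obtain ⟨p1, p2, p3⟩ := hI p hp
    have hm : p.2 ∈ Icc (0:ℝ) 1 := ⟨p1.trans p2.le, p3⟩
    rw [(hform _ hm _ hm).2, min_self]
    rintro ⟨q, hq, hpq, -⟩
    have hne : p ≠ q := by rintro rfl; exact lt_irrefl _ hpq.2
    obtain ⟨z, hz1, hz2⟩ := exists_between (max_lt p2 hpq.1)
    exact Set.disjoint_left.1 (hdisj hp hq hne) ⟨(le_max_left _ _).trans_lt hz1, hz2⟩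
      ⟨(le_max_right _ _).trans_lt hz1, hz2.trans hpq.2⟩
  -- data for each section
  have data : ∀ v ∈ Icc (0:ℝ) 1, ∃ a b s, 0 ≤ a ∧ a ≤ v ∧ v ≤ b ∧ b ≤ 1 ∧ 0 ≤ s ∧ s ≤ 1 ∧
      v = a + s * (b - a) ∧ C a a = a ∧ C b b = b ∧
      ∀ u ∈ Ioo a b, C u v = a + s * (u - a) := by
    intro v hv
    by_cases hex : ∃ p ∈ I, v ∈ Ioo p.1 p.2
    · obtain ⟨p, hp, hvp⟩ := hex
      obtain ⟨p1, p2, p3⟩ := hI p hp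
      have hpos : 0 < p.2 - p.1 := by linarith
      refine ⟨p.1, p.2, (v - p.1) / (p.2 - p.1), p1, hvp.1.le, hvp.2.le, p3,
        div_nonneg (by linarith [hvp.1]) hpos.le, (div_le_one hpos).2 (by linarith [hvp.2]),
        ?_, fixl p hp, fixr p hp, ?_⟩
      · field_simp; ring
      · intro u hu
        rw [(hform u ⟨p1.trans hu.1.le, hu.2.le.trans p3⟩ v hv).1 p hp hu hvp]
        field_simp
    · have hvv : C v v = v := by
        rw [(hform v hv v hv).2, min_self]
        rintro ⟨p, hp, h1, -⟩
        exact hex ⟨p, hp, h1⟩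
      refine ⟨v, v, 0, hv.1, le_rfl, le_rfl, hv.2, le_rfl, zero_le_one, by ring, hvv, hvv, ?_⟩
      intro u hu
      exact absurd (hu.1.trans hu.2) (lt_irrefl _)
  have full : ∀ v ∈ Icc (0:ℝ) 1, ∃ a b s, 0 ≤ a ∧ a ≤ v ∧ v ≤ b ∧ b ≤ 1 ∧ 0 ≤ s ∧ s ≤ 1 ∧
      v = a + s * (b - a) ∧ C a a = a ∧ C b b = b ∧
      (∀ u ∈ Icc 0 a, C u v = u) ∧ (∀ u ∈ Icc b 1, C u v = v) ∧
      (∀ u ∈ Ioo a b, C u v = a + s * (u - a)) := by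
    intro v hv
    obtain ⟨a, b, s, h1, h2, h3, h4, h5, h6, h7, h8, h9, h10⟩ := data v hv
    refine ⟨a, b, s, h1, h2, h3, h4, h5, h6, h7, h8, h9, ?_, ?_, h10⟩
    · intro u hu
      rw [hC.eq_min_of_fix ⟨hu.1, (hu.2.trans h2).trans hv.2⟩ hv ⟨h1, h2.trans hv.2⟩ h8
        (Or.inl ⟨hu.2, h2⟩), min_eq_left (hu.2.trans h2)]
    · intro u hu
      rw [hC.eq_min_of_fix ⟨(hv.1.trans h3).trans hu.1, hu.2⟩ hv ⟨hv.1.trans h3, h4⟩ h9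
        (Or.inr ⟨h3, hu.1⟩), min_eq_right (h3.trans hu.1)]
  constructor
  · intro u hu v hv
    obtain ⟨a, b, s, h1, h2, h3, h4, h5, h6, h7, h8, h9, h10, h11, h12⟩ := full v hv
    have hab := h2.trans h3
    have ma : a ∈ Icc (0:ℝ) 1 := ⟨h1, hab.trans h4⟩
    have mb : b ∈ Icc (0:ℝ) 1 := ⟨h1.trans hab, h4⟩
    rw [markov_pw hC hu h1 hab h4 (fun t ht => h10 t ⟨ht.1.le, ht.2.le⟩) h12
      (fun t ht => h11 t ⟨ht.1.le, ht.2.le⟩)]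
    have ea : C u a = min u a := hC.eq_min_of_fix hu ma ma h8
      ((le_total u a).imp (fun h => ⟨h, le_rfl⟩) (fun h => ⟨le_rfl, h⟩))
    have eb : C u b = min u b := hC.eq_min_of_fix hu mb mb h9
      ((le_total u b).imp (fun h => ⟨h, le_rfl⟩) (fun h => ⟨le_rfl, h⟩))
    rw [ea, eb]
    rcases le_or_gt u a with hua | hua
    · rw [h10 u ⟨hu.1, hua⟩, min_eq_left hua, min_eq_left (hua.trans hab)]; ring
    · rcases le_or_gt b u with hub | hub
      · rw [h11 u ⟨hub, hu.2⟩, min_eq_right hua.le, min_eq_right hub]; linarith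
      · rw [h12 u ⟨hua, hub⟩, min_eq_right hua.le, min_eq_left hub.le]
  · intro v hv
    obtain ⟨a, b, s, h1, h2, h3, h4, h5, h6, h7, h8, h9, h10, h11, h12⟩ := full v hv
    have hab := h2.trans h3
    have hcv : Convex ℝ (Icc (0:ℝ) 1) := convex_Icc 0 1
    have haff : ConcaveOn ℝ (Icc (0:ℝ) 1) (fun u => a + s * (u - a)) := by
      refine ⟨hcv, fun x _ y _ p q _ _ hpq => ?_⟩
      simp only [smul_eq_mul]
      have : p = 1 - q := by linarith
      subst this
      apply le_of_eq; ring
    have hc1 : ConcaveOn ℝ (Icc (0:ℝ) 1) (id : ℝ → ℝ) := concaveOn_id hcv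
    have hc2 : ConcaveOn ℝ (Icc (0:ℝ) 1) (fun _ : ℝ => v) := concaveOn_const v hcv
    have hmin := (hc1.inf haff).inf hc2
    refine hmin.congr fun u hu => ?_
    simp only [Pi.inf_apply, id]
    rcases le_or_gt u a with hua | hua
    · rw [h10 u ⟨hu.1, hua⟩, inf_eq_left.2, inf_eq_left.2]
      · nlinarith
      · rw [inf_eq_left.2]
        · exact hua.trans h2
        · nlinarith
    · rcases le_or_gt b u with hub | hub
      · rw [h11 u ⟨hub, hu.2⟩, inf_eq_right.2]
        refine _root_.le_inf (h3.trans hub) ?_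
        nlinarith
      · rw [h12 u ⟨hua, hub⟩, inf_eq_left.2, inf_eq_right.2]
        · nlinarith
        · refine inf_le_right.trans ?_
          nlinarith

theorem idempotent_stochIncr_iff_ordinalSumPi (C : ℝ → ℝ → ℝ) (hC : IsCopula C) :
    ((∀ u ∈ Icc (0:ℝ) 1, ∀ v ∈ Icc (0:ℝ) 1, MarkovProduct C C u v = C u v) ∧
        StochIncr C) ↔ IsOrdinalSumOfPi C := by
  constructor
  · rintro ⟨h1, h2⟩
    exact forward_dir hC h1 h2
  · exact backward_dir hC
end

section
/- Let C be a 2-copula that is stochastically increasing in the first component. Then the sequence of Markov-product iterates C^{*n} = C * C * ⋯ * C (n factors) is pointwise decreasing in n and converges pointwise to an idempotent, stochastically increasing 2-copula C*, which is an ordinal sum of copies of the product copula Π over some countable family of disjoint intervals. -/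
open MeasureTheory Set Filter

/-- Markov-product iterates of a copula: C^{*1} = C, C^{*(n+1)} = C * C^{*n}. -/
noncomputable def markovIter (C : ℝ → ℝ → ℝ) : ℕ → ℝ → ℝ → ℝ
  | 0 => C
  | n + 1 => MarkovProduct C (markovIter C n)

def Lip1 (f : ℝ → ℝ) : Prop :=
  ∀ x ∈ Icc (0:ℝ) 1, ∀ y ∈ Icc (0:ℝ) 1, x ≤ y → 0 ≤ f y - f x ∧ f y - f x ≤ y - x

lemma Lip1.lip {f : ℝ → ℝ} (hf : Lip1 f) : LipschitzOnWith 1 f (Icc 0 1) := by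
  apply LipschitzOnWith.of_dist_le_mul
  intro x hx y hy
  rw [Real.dist_eq, Real.dist_eq]
  rcases le_total x y with h | h
  · have := hf x hx y hy h
    rw [abs_sub_comm, abs_of_nonneg this.1, abs_sub_comm x y, abs_of_nonneg (by linarith)]
    simpa using this.2
  · have := hf y hy x hx h
    rw [abs_of_nonneg this.1, abs_of_nonneg (by linarith)]
    simpa using this.2

lemma Lip1.ac {f : ℝ → ℝ} (hf : Lip1 f) : AbsolutelyContinuousOnInterval f 0 1 := by
  have := hf.lip
  rw [← uIcc_of_le (zero_le_one' ℝ)] at this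
  exact this.absolutelyContinuousOnInterval

lemma Lip1.int {f : ℝ → ℝ} (hf : Lip1 f) {x y : ℝ} (hx : x ∈ Icc (0:ℝ) 1)
    (hy : y ∈ Icc (0:ℝ) 1) : IntervalIntegrable (deriv f) volume x y :=
  (hf.ac.intervalIntegrable_deriv).mono_set
    (by rw [uIcc_of_le (zero_le_one' ℝ)]; exact (convex_Icc (0:ℝ) 1).ordConnected.uIcc_subset hx hy)

lemma Lip1.ftc {f : ℝ → ℝ} (hf : Lip1 f) {x y : ℝ} (hx : x ∈ Icc (0:ℝ) 1)
    (hy : y ∈ Icc (0:ℝ) 1) : ∫ t in x..y, deriv f t = f y - f x :=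
  (hf.ac.mono
    (by rw [uIcc_of_le (zero_le_one' ℝ)]
        exact (convex_Icc (0:ℝ) 1).ordConnected.uIcc_subset hx hy)).integral_deriv_eq_sub

lemma Lip1.bd {f : ℝ → ℝ} (hf : Lip1 f) {t : ℝ} (ht : t ∈ Ioo (0:ℝ) 1)
    (hd : DifferentiableAt ℝ f t) : 0 ≤ deriv f t ∧ deriv f t ≤ 1 := by
  have h := hasDerivWithinAt_iff_tendsto_slope.1 (hd.hasDerivAt.hasDerivWithinAt (s := Ioi t))
  rw [show Ioi t \ {t} = Ioi t by simp] at h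
  have hev : ∀ᶠ y in nhdsWithin t (Ioi t), y ∈ Ioo t 1 := Ioo_mem_nhdsGT ht.2
  constructor
  · refine ge_of_tendsto h (hev.mono fun y hy => ?_)
    have := hf t ⟨ht.1.le, ht.2.le⟩ y ⟨by linarith [ht.1, hy.1], hy.2.le⟩ hy.1.le
    rw [slope_def_field]
    exact div_nonneg this.1 (by linarith [hy.1])
  · refine le_of_tendsto h (hev.mono fun y hy => ?_)
    have := hf t ⟨ht.1.le, ht.2.le⟩ y ⟨by linarith [ht.1, hy.1], hy.2.le⟩ hy.1.le
    rw [slope_def_field, div_le_one (by linarith [hy.1])]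
    exact this.2

lemma Lip1.ae_diff {f : ℝ → ℝ} (hf : Lip1 f) :
    ∀ᵐ t : ℝ, t ∈ Ioo (0:ℝ) 1 → DifferentiableAt ℝ f t := by
  filter_upwards [hf.lip.ae_differentiableWithinAt_of_mem] with t h ht
  exact (h ⟨ht.1.le, ht.2.le⟩).differentiableAt (Icc_mem_nhds ht.1 ht.2)

lemma ae_Ioc {p : ℝ → Prop} (h : ∀ᵐ t : ℝ, t ∈ Ioo (0:ℝ) 1 → p t) :
    ∀ᵐ t : ℝ, t ∈ Ioc (0:ℝ) 1 → p t := by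
  have h1 : ∀ᵐ t : ℝ, t ≠ 1 := by simp [ae_iff]
  filter_upwards [h, h1] with t h h1 ht
  exact h ⟨ht.1, lt_of_le_of_ne ht.2 h1⟩

lemma exists_gamma {G : ℝ → ℝ} (hG : Lip1 G) (hc : ConcaveOn ℝ (Icc (0:ℝ) 1) G) :
    ∃ γ : ℝ → ℝ, Antitone γ ∧ (∀ t, 0 ≤ γ t ∧ γ t ≤ 1) ∧
      ∀ᵐ t : ℝ, t ∈ Ioc (0:ℝ) 1 → deriv G t = γ t := by
  set S := {t | t ∈ Ioo (0:ℝ) 1 ∧ DifferentiableAt ℝ G t} with hS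
  have hanti : AntitoneOn (deriv G) S := by
    intro s hs t ht hst
    rcases hst.eq_or_lt with rfl | hst
    · exact le_rfl
    exact (hc.deriv_le_slope (Ioo_subset_Icc_self hs.1) (Ioo_subset_Icc_self ht.1) hst ht.2).trans
      (hc.slope_le_deriv (Ioo_subset_Icc_self hs.1) (Ioo_subset_Icc_self ht.1) hst hs.2)
  obtain ⟨g, hg, hgS⟩ := hanti.exists_antitone_extension
    ⟨0, by rintro _ ⟨t, ht, rfl⟩; exact (hG.bd ht.1 ht.2).1⟩
    ⟨1, by rintro _ ⟨t, ht, rfl⟩; exact (hG.bd ht.1 ht.2).2⟩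
  refine ⟨fun t => max 0 (min 1 (g t)), ?_, ?_, ?_⟩
  · intro s t hst
    exact max_le_max le_rfl (min_le_min le_rfl (hg hst))
  · intro t
    exact ⟨le_max_left _ _, max_le zero_le_one (min_le_left _ _)⟩
  · apply ae_Ioc
    filter_upwards [hG.ae_diff] with t h ht
    have hb := hG.bd ht (h ht)
    have e : deriv G t = g t := hgS ⟨ht, h ht⟩
    rw [← e, min_eq_right hb.2, max_eq_right hb.1]

lemma lower_int {w : ℝ → ℝ} (hW : ∀ s ∈ Icc (0:ℝ) 1, 0 ≤ ∫ t in (0:ℝ)..s, w t)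
    {A : Set ℝ} (hA : ∀ s t, s ≤ t → t ∈ A → s ∈ A) (hAm : MeasurableSet A) :
    0 ≤ ∫ t in Ioc (0:ℝ) 1, A.indicator w t := by
  rw [setIntegral_indicator hAm]
  set B := insert 0 (Ioc (0:ℝ) 1 ∩ A) with hB
  have hbd : BddAbove B := ⟨1, by
    rintro t (rfl | ht)
    · exact zero_le_one
    · exact ht.1.2⟩
  have h0 : 0 ≤ sSup B := le_csSup hbd (by simp [hB])
  have h1 : sSup B ≤ 1 := csSup_le ⟨0, by simp [hB]⟩ (by
    rintro t (rfl | ht)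
    · exact zero_le_one
    · exact ht.1.2)
  have key : (Ioc (0:ℝ) 1 ∩ A : Set ℝ) =ᵐ[volume] Ioc (0:ℝ) (sSup B) := by
    have hne : ∀ᵐ t : ℝ, t ≠ sSup B := by simp [ae_iff]
    filter_upwards [hne] with t ht
    apply propext
    change t ∈ Ioc (0:ℝ) 1 ∩ A ↔ t ∈ Ioc (0:ℝ) (sSup B)
    constructor
    · intro h
      exact ⟨h.1.1, le_csSup hbd (Or.inr h)⟩
    · intro h
      obtain ⟨b, hb, htb⟩ := exists_lt_of_lt_csSup ⟨0, by simp [hB]⟩ (lt_of_le_of_ne h.2 ht)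
      rcases hb with rfl | hb
      · exact absurd h.1 (not_lt.2 htb.le)
      · exact ⟨⟨h.1, h.2.trans h1⟩, hA t b htb.le hb.2⟩
  rw [setIntegral_congr_set key, ← intervalIntegral.integral_of_le h0]
  exact hW _ ⟨h0, h1⟩

lemma abel {w γ : ℝ → ℝ} (hw : IntervalIntegrable w volume 0 1)
    (hW : ∀ s ∈ Icc (0:ℝ) 1, 0 ≤ ∫ t in (0:ℝ)..s, w t)
    (hγ : Antitone γ) (hb : ∀ t, 0 ≤ γ t ∧ γ t ≤ 1) :
    0 ≤ ∫ t in (0:ℝ)..1, w t * γ t := by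
  rw [intervalIntegral.integral_of_le zero_le_one]
  have hw' : Integrable w (volume.restrict (Ioc 0 1)) :=
    (intervalIntegrable_iff_integrableOn_Ioc_of_le zero_le_one).1 hw
  have hM : MeasurableSet {p : ℝ × ℝ | p.2 < γ p.1} :=
    measurableSet_lt measurable_snd (hγ.measurable.comp measurable_fst)
  have e1 : ∀ t, w t * γ t = ∫ r in Ioc (0:ℝ) 1,
      {p : ℝ × ℝ | p.2 < γ p.1}.indicator (fun p => w p.1) (t, r) := by
    intro t
    have : ∀ r, {p : ℝ × ℝ | p.2 < γ p.1}.indicator (fun p => w p.1) (t, r)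
        = (Iio (γ t)).indicator (fun _ => w t) r := by
      intro r
      simp [indicator]
    simp_rw [this]
    rw [setIntegral_indicator measurableSet_Iio]
    have e : (Ioc (0:ℝ) 1 ∩ Iio (γ t)) = Ioo 0 (γ t) := by
      ext r
      simp only [mem_inter_iff, mem_Ioc, mem_Iio, mem_Ioo]
      constructor
      · rintro ⟨h, h'⟩; exact ⟨h.1, h'⟩
      · rintro ⟨h, h'⟩; exact ⟨⟨h, by linarith [(hb t).2]⟩, h'⟩
    rw [e]
    simp [(hb t).1, mul_comm]
  simp_rw [e1]
  rw [integral_integral_swap]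
  · apply integral_nonneg
    intro r
    have : ∀ t, {p : ℝ × ℝ | p.2 < γ p.1}.indicator (fun p => w p.1) (t, r)
        = {t | r < γ t}.indicator w t := by
      intro t
      simp [indicator]
    simp_rw [this]
    exact lower_int hW (fun s t hst ht => lt_of_lt_of_le ht (hγ hst))
      (measurableSet_lt measurable_const hγ.measurable)
  · exact (hw'.comp_fst (volume.restrict (Ioc (0:ℝ) 1))).indicator hM

lemma int_mul {h g : ℝ → ℝ} (hh : IntervalIntegrable h volume 0 1) (hg : Measurable g)
    (hb : ∀ᵐ t : ℝ, t ∈ Ioc (0:ℝ) 1 → 0 ≤ g t ∧ g t ≤ 1) :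
    IntervalIntegrable (fun t => h t * g t) volume 0 1 := by
  rw [intervalIntegrable_iff_integrableOn_Ioc_of_le zero_le_one] at hh ⊢
  refine Integrable.mul_bdd (c := 1) hh hg.aestronglyMeasurable ?_
  rw [ae_restrict_iff' measurableSet_Ioc]
  filter_upwards [hb] with t h ht
  rw [Real.norm_eq_abs, abs_of_nonneg (h ht).1]
  exact (h ht).2

lemma sub_int {h : ℝ → ℝ} (hh : IntervalIntegrable h volume 0 1) {x y : ℝ}
    (hx : x ∈ Icc (0:ℝ) 1) (hy : y ∈ Icc (0:ℝ) 1) : IntervalIntegrable h volume x y :=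
  hh.mono_set (by rw [uIcc_of_le (zero_le_one' ℝ)];
                  exact (convex_Icc (0:ℝ) 1).ordConnected.uIcc_subset hx hy)

lemma mono_int {f g : ℝ → ℝ} (hf : IntervalIntegrable f volume 0 1)
    (hg : IntervalIntegrable g volume 0 1) {x y : ℝ}
    (hx : x ∈ Icc (0:ℝ) 1) (hy : y ∈ Icc (0:ℝ) 1) (hxy : x ≤ y)
    (h : ∀ᵐ t : ℝ, t ∈ Ioc (0:ℝ) 1 → t ∈ Ioc x y → f t ≤ g t) :
    ∫ t in x..y, f t ≤ ∫ t in x..y, g t := by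
  rw [intervalIntegral.integral_of_le hxy, intervalIntegral.integral_of_le hxy]
  have hf' := (intervalIntegrable_iff_integrableOn_Ioc_of_le hxy).1 (sub_int hf hx hy)
  have hg' := (intervalIntegrable_iff_integrableOn_Ioc_of_le hxy).1 (sub_int hg hx hy)
  refine setIntegral_mono_ae_restrict hf' hg' ?_
  change ∀ᵐ t ∂(volume.restrict (Ioc x y)), f t ≤ g t
  rw [ae_restrict_iff' measurableSet_Ioc]
  filter_upwards [h] with t h ht
  exact h ⟨lt_of_le_of_lt hx.1 ht.1, ht.2.trans hy.2⟩ ht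

lemma keyA {h γ : ℝ → ℝ} (hh : IntervalIntegrable h volume 0 1)
    (hb : ∀ᵐ t : ℝ, t ∈ Ioc (0:ℝ) 1 → 0 ≤ h t ∧ h t ≤ 1) {s u : ℝ}
    (hu : ∫ t in (0:ℝ)..1, h t = u) (hγ : Antitone γ) (hγb : ∀ t, 0 ≤ γ t ∧ γ t ≤ 1)
    (hs : 0 ≤ s) (hsu : s ≤ u) (hu1 : u ≤ 1) :
    (s - ∫ t in (0:ℝ)..s, h t) * (γ s - γ u) ≤
      (∫ t in (0:ℝ)..u, γ t) - ∫ t in (0:ℝ)..1, h t * γ t := by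
  have m0 : (0:ℝ) ∈ Icc (0:ℝ) 1 := by simp
  have m1 : (1:ℝ) ∈ Icc (0:ℝ) 1 := by simp
  have ms : s ∈ Icc (0:ℝ) 1 := ⟨hs, hsu.trans hu1⟩
  have mu : u ∈ Icc (0:ℝ) 1 := ⟨hs.trans hsu, hu1⟩
  have iγ : IntervalIntegrable γ volume 0 1 := hγ.intervalIntegrable
  have ihγ := int_mul hh hγ.measurable (ae_of_all _ fun t _ => hγb t)
  have i1 : IntervalIntegrable (fun t => 1 - h t) volume 0 1 := intervalIntegrable_const.sub hh
  have i1γ := int_mul i1 hγ.measurable (ae_of_all _ fun t _ => hγb t)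
  have a1 : ∫ t in u..1, h t * γ t ≤ ∫ t in u..1, h t * γ u :=
    mono_int ihγ (hh.mul_const _) mu m1 hu1 (by
      filter_upwards [hb] with t h1 h2 h3
      exact mul_le_mul_of_nonneg_left (hγ h3.1.le) (h1 h2).1)
  have a2 : ∫ t in (0:ℝ)..s, (1 - h t) * γ s ≤ ∫ t in (0:ℝ)..s, (1 - h t) * γ t :=
    mono_int (i1.mul_const _) i1γ m0 ms hs (by
      filter_upwards [hb] with t h1 h2 h3
      exact mul_le_mul_of_nonneg_left (hγ h3.2) (by linarith [(h1 h2).2]))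
  have a3 : ∫ t in s..u, (1 - h t) * γ u ≤ ∫ t in s..u, (1 - h t) * γ t :=
    mono_int (i1.mul_const _) i1γ ms mu hsu (by
      filter_upwards [hb] with t h1 h2 h3
      exact mul_le_mul_of_nonneg_left (hγ h3.2) (by linarith [(h1 h2).2]))
  rw [intervalIntegral.integral_mul_const] at a1
  rw [intervalIntegral.integral_mul_const, intervalIntegral.integral_sub intervalIntegrable_const
    (sub_int hh m0 ms)] at a2
  rw [intervalIntegral.integral_mul_const, intervalIntegral.integral_sub intervalIntegrable_const
    (sub_int hh ms mu)] at a3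
  have b1 := intervalIntegral.integral_add_adjacent_intervals (sub_int ihγ m0 mu) (sub_int ihγ mu m1)
  have b2 := intervalIntegral.integral_add_adjacent_intervals (sub_int i1γ m0 ms) (sub_int i1γ ms mu)
  have b3 := intervalIntegral.integral_add_adjacent_intervals (sub_int hh m0 ms) (sub_int hh ms mu)
  have b4 := intervalIntegral.integral_add_adjacent_intervals (sub_int hh m0 mu) (sub_int hh mu m1)
  have b5 : ∫ t in (0:ℝ)..u, (1 - h t) * γ t =
      (∫ t in (0:ℝ)..u, γ t) - ∫ t in (0:ℝ)..u, h t * γ t := by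
    rw [← intervalIntegral.integral_sub (sub_int iγ m0 mu) (sub_int ihγ m0 mu)]
    congr 1
    ext t
    ring
  simp only [intervalIntegral.integral_const, smul_eq_mul, mul_one, sub_zero] at a2 a3
  have c1 : ∫ t in u..1, h t = u - (∫ t in (0:ℝ)..u, h t) := by linarith
  have c2 : ∫ t in s..u, h t = (∫ t in (0:ℝ)..u, h t) - (∫ t in (0:ℝ)..s, h t) := by linarith
  rw [c1] at a1
  rw [c2] at a3
  nlinarith

lemma IsCopula.lip2 {C : ℝ → ℝ → ℝ} (hC : IsCopula C) {u : ℝ} (hu : u ∈ Icc (0:ℝ) 1) :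
    Lip1 (fun s => C u s) := by
  intro x hx y hy hxy
  have h1 := hC.2.2 0 u x y (by simp) hu hx hy hu.1 hxy
  have h2 := hC.2.2 u 1 x y hu (by simp) hx hy hu.2 hxy
  have := hC.2.1 x hx
  have := hC.2.1 y hy
  constructor <;> dsimp only <;> linarith

lemma IsCopula.lip1 {C : ℝ → ℝ → ℝ} (hC : IsCopula C) {v : ℝ} (hv : v ∈ Icc (0:ℝ) 1) :
    Lip1 (fun s => C s v) := by
  intro x hx y hy hxy
  have h1 := hC.2.2 x y 0 v hx hy (by simp) hv hxy hv.1
  have h2 := hC.2.2 x y v 1 hx hy hv (by simp) hxy hv.2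
  have := hC.1 x hx
  have := hC.1 y hy
  constructor <;> dsimp only <;> linarith

lemma deriv_mono_ae {f g : ℝ → ℝ} (hf : Lip1 f) (hg : Lip1 g) 
    (h : ∀ x ∈ Icc (0:ℝ) 1, ∀ y ∈ Icc (0:ℝ) 1, x ≤ y → 0 ≤ (f y - g y) - (f x - g x)) :
    ∀ᵐ t : ℝ, t ∈ Ioc (0:ℝ) 1 → 0 ≤ deriv f t - deriv g t := by
  apply ae_Ioc
  have hl : Lip1 (fun t => f t - g t) := by
    intro x hx y hy hxy
    refine ⟨h x hx y hy hxy, ?_⟩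
    have h1 := hf x hx y hy hxy
    have h2 := hg x hx y hy hxy
    dsimp only
    linarith
  filter_upwards [hf.ae_diff, hg.ae_diff] with t h1 h2 ht
  have := (hl.bd ht ((h1 ht).sub (h2 ht))).1
  rwa [deriv_fun_sub (h1 ht) (h2 ht)] at this

lemma Lip1.ae_bd {f : ℝ → ℝ} (hf : Lip1 f) :
    ∀ᵐ t : ℝ, t ∈ Ioc (0:ℝ) 1 → 0 ≤ deriv f t ∧ deriv f t ≤ 1 := by
  apply ae_Ioc
  filter_upwards [hf.ae_diff] with t h ht
  exact hf.bd ht (h ht)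

lemma Lip1.prod {f g : ℝ → ℝ} (hf : Lip1 f) (hg : Lip1 g) :
    IntervalIntegrable (fun t => deriv f t * deriv g t) volume 0 1 :=
  int_mul (hf.int (by simp) (by simp)) (measurable_deriv g) hg.ae_bd

lemma congr_int {f g : ℝ → ℝ} {x y : ℝ} (hx : x ∈ Icc (0:ℝ) 1) (hy : y ∈ Icc (0:ℝ) 1) (hxy : x ≤ y)
    (h : ∀ᵐ t : ℝ, t ∈ Ioc (0:ℝ) 1 → t ∈ Ioc x y → f t = g t) :
    ∫ t in x..y, f t = ∫ t in x..y, g t := by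
  apply intervalIntegral.integral_congr_ae
  filter_upwards [h] with t h ht
  rw [uIoc_of_le hxy] at ht
  exact h ⟨lt_of_le_of_lt hx.1 ht.1, ht.2.trans hy.2⟩ ht

lemma deriv_congr_Icc {f g : ℝ → ℝ} {x y : ℝ} (h : ∀ t ∈ Icc x y, f t = g t) {t : ℝ}
    (ht : t ∈ Ioo x y) : deriv f t = deriv g t := by
  apply Filter.EventuallyEq.deriv_eq
  filter_upwards [Icc_mem_nhds ht.1 ht.2] with s hs using h s hs

/-- combination of min's -/
lemma mp_min {f g : ℝ → ℝ} {a b α β : ℝ} (ha : a ∈ Icc (0:ℝ) 1) (hb : b ∈ Icc (0:ℝ) 1)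
    (hf : ∀ t ∈ Icc (0:ℝ) 1, f t = α * min a t + β * min b t) (hg : Lip1 g) (hg0 : g 0 = 0) :
    ∫ t in (0:ℝ)..1, deriv f t * deriv g t = α * g a + β * g b := by
  have m0 : (0:ℝ) ∈ Icc (0:ℝ) 1 := by simp
  have m1 : (1:ℝ) ∈ Icc (0:ℝ) 1 := by simp
  have dmin : ∀ c t : ℝ, t ≠ c →
      HasDerivAt (fun t => min c t) ((Iio c).indicator (fun _ => (1:ℝ)) t) t := by
    intro c t htc
    rcases lt_or_gt_of_ne htc with h | h
    · rw [indicator_of_mem (show t ∈ Iio c from h)]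
      refine (hasDerivAt_id t).congr_of_eventuallyEq ?_
      filter_upwards [Iio_mem_nhds h] with s hs
      exact min_eq_right (le_of_lt hs)
    · rw [indicator_of_notMem (show t ∉ Iio c from not_lt.2 h.le)]
      refine (hasDerivAt_const t c).congr_of_eventuallyEq ?_
      filter_upwards [Ioi_mem_nhds h] with s hs
      exact min_eq_left (le_of_lt hs)
  have imin : ∀ c ∈ Icc (0:ℝ) 1,
      IntervalIntegrable (fun t => (Iio c).indicator (fun _ => (1:ℝ)) t * deriv g t) volume 0 1 ∧
      ∫ t in (0:ℝ)..1, (Iio c).indicator (fun _ => (1:ℝ)) t * deriv g t = g c := by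
    intro c hc
    have ii : IntervalIntegrable (fun t => (Iio c).indicator (fun _ => (1:ℝ)) t * deriv g t)
        volume 0 1 := by
      have := int_mul (hg.int m0 m1) (g := (Iio c).indicator (fun _ => (1:ℝ)))
        (measurable_const.indicator measurableSet_Iio) (ae_of_all _ fun t _ => by
          by_cases h : t ∈ Iio c
          · rw [indicator_of_mem h]; norm_num
          · rw [indicator_of_notMem h]; norm_num)
      simpa only [mul_comm] using this
    refine ⟨ii, ?_⟩
    rw [← intervalIntegral.integral_add_adjacent_intervals (sub_int ii m0 hc) (sub_int ii hc m1)]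
    have e1 : ∫ t in (0:ℝ)..c, (Iio c).indicator (fun _ => (1:ℝ)) t * deriv g t
        = ∫ t in (0:ℝ)..c, deriv g t := by
      apply congr_int m0 hc hc.1
      have : ∀ᵐ t : ℝ, t ≠ c := by simp [ae_iff]
      filter_upwards [this] with t h _ ht
      rw [indicator_of_mem (show t ∈ Iio c from lt_of_le_of_ne ht.2 h), one_mul]
    have e2 : ∫ t in c..1, (Iio c).indicator (fun _ => (1:ℝ)) t * deriv g t
        = ∫ t in c..1, (0:ℝ) := by
      apply congr_int hc m1 hc.2
      filter_upwards with t _ ht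
      rw [indicator_of_notMem (show t ∉ Iio c from not_lt.2 ht.1.le), zero_mul]
    rw [e1, e2, hg.ftc m0 hc, hg0]
    simp
  have key : ∫ t in (0:ℝ)..1, deriv f t * deriv g t = ∫ t in (0:ℝ)..1,
      (α * ((Iio a).indicator (fun _ => (1:ℝ)) t * deriv g t) +
       β * ((Iio b).indicator (fun _ => (1:ℝ)) t * deriv g t)) := by
    apply congr_int m0 m1 zero_le_one
    have h1 : ∀ᵐ t : ℝ, t ≠ a := by simp [ae_iff]
    have h2 : ∀ᵐ t : ℝ, t ≠ b := by simp [ae_iff]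
    have h3 : ∀ᵐ t : ℝ, t ≠ 1 := by simp [ae_iff]
    filter_upwards [h1, h2, h3] with t h1 h2 h3 ht _
    rw [deriv_congr_Icc hf ⟨ht.1, lt_of_le_of_ne ht.2 h3⟩,
      (((dmin a t h1).const_mul α).fun_add ((dmin b t h2).const_mul β)).deriv]
    ring
  rw [key, intervalIntegral.integral_add ((imin a ha).1.const_mul α) ((imin b hb).1.const_mul β),
    intervalIntegral.integral_const_mul, intervalIntegral.integral_const_mul,
    (imin a ha).2, (imin b hb).2]

lemma mp_copula {C D : ℝ → ℝ → ℝ} (hC : IsCopula C) (hD : IsCopula D) :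
    IsCopula (MarkovProduct C D) := by
  have m0 : (0:ℝ) ∈ Icc (0:ℝ) 1 := by simp
  have m1 : (1:ℝ) ∈ Icc (0:ℝ) 1 := by simp
  have n1 : ∀ᵐ t : ℝ, t ≠ 1 := by simp [ae_iff]
  refine ⟨fun u hu => ⟨?_, ?_⟩, fun v hv => ⟨?_, ?_⟩, ?_⟩
  · have : MarkovProduct C D u 0 = ∫ t in (0:ℝ)..1, (0:ℝ) := by
      apply congr_int m0 m1 zero_le_one
      filter_upwards [n1] with t h1 ht _
      rw [deriv_congr_Icc (g := fun _ => (0:ℝ)) (fun s hs => (hD.1 s hs).1)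
        ⟨ht.1, lt_of_le_of_ne ht.2 h1⟩]
      simp
    rw [this]; simp
  · have : MarkovProduct C D u 1 = ∫ t in (0:ℝ)..1, deriv (fun s => C u s) t := by
      apply congr_int m0 m1 zero_le_one
      filter_upwards [n1] with t h1 ht _
      rw [deriv_congr_Icc (f := fun s => D s 1) (g := fun s => s) (fun s hs => (hD.1 s hs).2)
        ⟨ht.1, lt_of_le_of_ne ht.2 h1⟩]
      simp
    rw [this, (hC.lip2 hu).ftc m0 m1, (hC.1 u hu).1, (hC.1 u hu).2, sub_zero]
  · have : MarkovProduct C D 0 v = 0 * D 0 v + 0 * D 0 v :=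
      mp_min m0 m0 (fun t ht => by simp [(hC.2.1 t ht).1]) (hD.lip1 hv) (hD.2.1 v hv).1
    simpa using this
  · have : MarkovProduct C D 1 v = 1 * D 1 v + 0 * D 1 v :=
      mp_min m1 m1 (fun t ht => by simp [(hC.2.1 t ht).2, ht.2]) (hD.lip1 hv) (hD.2.1 v hv).1
    rw [this, (hD.2.1 v hv).2]; ring
  · intro u₁ u₂ v₁ v₂ hu₁ hu₂ hv₁ hv₂ hu hv
    unfold MarkovProduct
    have i22 := (hC.lip2 hu₂).prod (hD.lip1 hv₂)
    have i21 := (hC.lip2 hu₂).prod (hD.lip1 hv₁)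
    have i12 := (hC.lip2 hu₁).prod (hD.lip1 hv₂)
    have i11 := (hC.lip2 hu₁).prod (hD.lip1 hv₁)
    rw [← intervalIntegral.integral_sub i22 i21, ← intervalIntegral.integral_sub (i22.sub i21) i12,
      ← intervalIntegral.integral_add ((i22.sub i21).sub i12) i11]
    have : ∫ t in (0:ℝ)..1, (0:ℝ) = 0 := by simp
    refine this.symm.le.trans ?_
    apply mono_int intervalIntegrable_const (((i22.sub i21).sub i12).add i11) m0 m1 zero_le_one
    filter_upwards [deriv_mono_ae (hC.lip2 hu₂) (hC.lip2 hu₁) (fun x hx y hy hxy => by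
        have := hC.2.2 u₁ u₂ x y hu₁ hu₂ hx hy hu hxy
        linarith), deriv_mono_ae (hD.lip1 hv₂) (hD.lip1 hv₁) (fun x hx y hy hxy => by
        have := hD.2.2 x y v₁ v₂ hx hy hv₁ hv₂ hxy hv
        linarith)] with t h1 h2 ht _
    have := mul_nonneg (h1 ht) (h2 ht)
    linarith

lemma mp_gamma {C D : ℝ → ℝ → ℝ} {γ : ℝ → ℝ} {v : ℝ}
    (h : ∀ᵐ t : ℝ, t ∈ Ioc (0:ℝ) 1 → deriv (fun s => D s v) t = γ t) (u : ℝ) :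
    MarkovProduct C D u v = ∫ t in (0:ℝ)..1, deriv (fun s => C u s) t * γ t := by
  apply congr_int (by simp) (by simp) zero_le_one
  filter_upwards [h] with t h ht _
  rw [h ht]

lemma mp_si {C D : ℝ → ℝ → ℝ} (hC : IsCopula C) (hCs : StochIncr C) (hD : IsCopula D)
    (hDs : StochIncr D) : StochIncr (MarkovProduct C D) := by
  have m0 : (0:ℝ) ∈ Icc (0:ℝ) 1 := by simp
  have m1 : (1:ℝ) ∈ Icc (0:ℝ) 1 := by simp
  intro v hv
  obtain ⟨γ, hγ, hγb, hγe⟩ := exists_gamma (hD.lip1 hv) (hDs v hv)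
  refine ⟨convex_Icc 0 1, ?_⟩
  intro x hx y hy a b ha hb hab
  have hz : a • x + b • y ∈ Icc (0:ℝ) 1 := convex_Icc (0:ℝ) 1 hx hy ha hb hab
  set z := a • x + b • y with hzdef
  simp only [smul_eq_mul]
  rw [mp_gamma hγe, mp_gamma hγe, mp_gamma hγe]
  have ix := (hC.lip2 hx).int m0 m1
  have iy := (hC.lip2 hy).int m0 m1
  have iz := (hC.lip2 hz).int m0 m1
  have bγ : ∀ᵐ t : ℝ, t ∈ Ioc (0:ℝ) 1 → 0 ≤ γ t ∧ γ t ≤ 1 := ae_of_all _ fun t _ => hγb t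
  have jx := int_mul ix hγ.measurable bγ
  have jy := int_mul iy hγ.measurable bγ
  have jz := int_mul iz hγ.measurable bγ
  have iw := iz.sub ((ix.const_mul a).add (iy.const_mul b))
  have := abel iw (fun s hs => by
    rw [intervalIntegral.integral_sub (sub_int iz m0 hs)
      (((sub_int ix m0 hs).const_mul a).add ((sub_int iy m0 hs).const_mul b)),
      intervalIntegral.integral_add ((sub_int ix m0 hs).const_mul a)
        ((sub_int iy m0 hs).const_mul b), intervalIntegral.integral_const_mul,
      intervalIntegral.integral_const_mul, (hC.lip2 hx).ftc m0 hs, (hC.lip2 hy).ftc m0 hs,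
      (hC.lip2 hz).ftc m0 hs]
    have h := (hCs s hs).2 hx hy ha hb hab
    simp only [smul_eq_mul] at h
    rw [(hC.1 x hx).1, (hC.1 y hy).1, (hC.1 z hz).1]
    simp only [hzdef, smul_eq_mul]
    linarith) hγ hγb
  have e : ∫ t in (0:ℝ)..1, (deriv (fun s => C z s) t - (a * deriv (fun s => C x s) t +
      b * deriv (fun s => C y s) t)) * γ t =
      (∫ t in (0:ℝ)..1, deriv (fun s => C z s) t * γ t) -
      (a * (∫ t in (0:ℝ)..1, deriv (fun s => C x s) t * γ t) +
       b * (∫ t in (0:ℝ)..1, deriv (fun s => C y s) t * γ t)) := by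
    rw [← intervalIntegral.integral_const_mul, ← intervalIntegral.integral_const_mul,
      ← intervalIntegral.integral_add (jx.const_mul a) (jy.const_mul b),
      ← intervalIntegral.integral_sub jz ((jx.const_mul a).add (jy.const_mul b))]
    congr 1
    ext t
    ring
  have this' : 0 ≤ ∫ t in (0:ℝ)..1, (deriv (fun s => C z s) t - (a * deriv (fun s => C x s) t +
      b * deriv (fun s => C y s) t)) * γ t := this
  rw [e] at this'
  linarith

lemma mp_key {C D : ℝ → ℝ → ℝ} (hC : IsCopula C) (hD : IsCopula D) {γ : ℝ → ℝ} {v : ℝ}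
    (hv : v ∈ Icc (0:ℝ) 1) (hγ : Antitone γ) (hγb : ∀ t, 0 ≤ γ t ∧ γ t ≤ 1)
    (hγe : ∀ᵐ t : ℝ, t ∈ Ioc (0:ℝ) 1 → deriv (fun s => D s v) t = γ t)
    {s u : ℝ} (hs : 0 ≤ s) (hsu : s ≤ u) (hu : u ≤ 1) :
    (s - C u s) * (γ s - γ u) ≤ D u v - MarkovProduct C D u v := by
  have m0 : (0:ℝ) ∈ Icc (0:ℝ) 1 := by simp
  have m1 : (1:ℝ) ∈ Icc (0:ℝ) 1 := by simp
  have ms : s ∈ Icc (0:ℝ) 1 := ⟨hs, hsu.trans hu⟩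
  have mu : u ∈ Icc (0:ℝ) 1 := ⟨hs.trans hsu, hu⟩
  have hl := hC.lip2 mu
  have e1 := hl.ftc m0 m1
  have e2 := hl.ftc m0 ms
  rw [(hC.1 u mu).1, sub_zero] at e1 e2
  rw [(hC.1 u mu).2] at e1
  have e3 := (hD.lip1 hv).ftc m0 mu
  rw [(hD.2.1 v hv).1, sub_zero] at e3
  have e4 : ∫ t in (0:ℝ)..u, deriv (fun s => D s v) t = ∫ t in (0:ℝ)..u, γ t :=
    congr_int m0 mu mu.1 (by filter_upwards [hγe] with t h ht _ using h ht)
  have := keyA (hl.int m0 m1) hl.ae_bd e1 hγ hγb hs hsu hu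
  rwa [e2, ← e4, e3, ← mp_gamma hγe] at this

lemma gamma_bd {D : ℝ → ℝ → ℝ} (hD : IsCopula D) {γ : ℝ → ℝ} {v : ℝ}
    (hv : v ∈ Icc (0:ℝ) 1) (hγ : Antitone γ)
    (hγe : ∀ᵐ t : ℝ, t ∈ Ioc (0:ℝ) 1 → deriv (fun s => D s v) t = γ t)
    {x y : ℝ} (hx : x ∈ Icc (0:ℝ) 1) (hy : y ∈ Icc (0:ℝ) 1) (hxy : x ≤ y) :
    (y - x) * γ y ≤ D y v - D x v ∧ D y v - D x v ≤ (y - x) * γ x := by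
  have e3 := (hD.lip1 hv).ftc hx hy
  have e4 : ∫ t in x..y, deriv (fun s => D s v) t = ∫ t in x..y, γ t :=
    congr_int hx hy hxy (by filter_upwards [hγe] with t h ht _ using h ht)
  rw [e4] at e3
  rw [← e3]
  have c1 := mono_int (f := fun _ => γ y) (g := γ) intervalIntegrable_const
    hγ.intervalIntegrable hx hy hxy (ae_of_all _ fun t _ ht => hγ ht.2)
  have c2 := mono_int (g := fun _ => γ x) (f := γ) hγ.intervalIntegrable intervalIntegrable_const
    hx hy hxy (ae_of_all _ fun t _ ht => hγ ht.1.le)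
  simp only [intervalIntegral.integral_const, smul_eq_mul] at c1 c2
  exact ⟨c1, c2⟩

lemma mp_le {C D : ℝ → ℝ → ℝ} (hC : IsCopula C) (hD : IsCopula D) (hDs : StochIncr D)
    {u v : ℝ} (hu : u ∈ Icc (0:ℝ) 1) (hv : v ∈ Icc (0:ℝ) 1) :
    MarkovProduct C D u v ≤ D u v := by
  obtain ⟨γ, hγ, hγb, hγe⟩ := exists_gamma (hD.lip1 hv) (hDs v hv)
  have := mp_key hC hD hv hγ hγb hγe hu.1 le_rfl hu.2
  simp only [sub_self, mul_zero] at this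
  linarith

lemma iter_prop {C : ℝ → ℝ → ℝ} (hC : IsCopula C) (hCs : StochIncr C) (n : ℕ) :
    IsCopula (markovIter C n) ∧ StochIncr (markovIter C n) := by
  induction n with
  | zero => exact ⟨hC, hCs⟩
  | succ n ih => exact ⟨mp_copula hC ih.1, mp_si hC hCs ih.1 ih.2⟩

lemma cop_min {D : ℝ → ℝ → ℝ} (hD : IsCopula D) {c t : ℝ} (hc : c ∈ Icc (0:ℝ) 1)
    (h : D c c = c) (ht : t ∈ Icc (0:ℝ) 1) : D c t = min c t := by
  have m1 : (1:ℝ) ∈ Icc (0:ℝ) 1 := by simp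
  rcases le_total t c with h1 | h1
  · rw [min_eq_right h1]
    have a1 := hD.lip2 hc t ht c hc h1
    have a2 := hD.lip1 ht c hc 1 m1 hc.2
    have := (hD.2.1 t ht).2
    dsimp only at a1 a2
    linarith
  · rw [min_eq_left h1]
    have a1 := hD.lip2 hc c hc t ht h1
    have a2 := hD.lip2 hc t ht 1 m1 ht.2
    have := (hD.1 c hc).2
    dsimp only at a1 a2
    linarith

lemma iter_fix {C : ℝ → ℝ → ℝ} (hC : IsCopula C) (hCs : StochIncr C) {c v : ℝ}
    (hc : c ∈ Icc (0:ℝ) 1) (h : C c c = c) (hv : v ∈ Icc (0:ℝ) 1) (n : ℕ) :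
    markovIter C n c v = min c v := by
  induction n with
  | zero => exact cop_min hC hc h hv
  | succ n ih =>
    have hD := (iter_prop hC hCs n).1
    have : MarkovProduct C (markovIter C n) c v
        = 1 * markovIter C n c v + 0 * markovIter C n c v :=
      mp_min hc hc (fun t ht => by rw [cop_min hC hc h ht]; ring) (hD.lip1 hv) (hD.2.1 v hv).1
    change MarkovProduct C (markovIter C n) c v = _
    rw [this, ih]; ring

lemma exists_comp {C : ℝ → ℝ → ℝ} (hC : IsCopula C) {u : ℝ} (hu : u ∈ Icc (0:ℝ) 1)
    (h : C u u ≠ u) : ∃ a b, a ∈ Icc (0:ℝ) 1 ∧ b ∈ Icc (0:ℝ) 1 ∧ C a a = a ∧ C b b = b ∧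
      a < u ∧ u < b ∧ ∀ c ∈ Ioo a b, C c c ≠ c := by
  have m0 : (0:ℝ) ∈ Icc (0:ℝ) 1 := by simp
  have m1 : (1:ℝ) ∈ Icc (0:ℝ) 1 := by simp
  have hl : Lip1 (fun c => C c c / 2) := by
    intro x hx y hy hxy
    have a1 := hC.lip1 hx x hx y hy hxy
    have a2 := hC.lip2 hy x hx y hy hxy
    dsimp only at *
    constructor <;> linarith
  have hcont : ContinuousOn (fun c => C c c / 2 - c / 2) (Icc 0 1) :=
    hl.lip.continuousOn.sub (by fun_prop)
  have hcl := hcont.preimage_isClosed_of_isClosed isClosed_Icc (isClosed_singleton (x := (0:ℝ)))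
  set K := Icc (0:ℝ) 1 ∩ (fun c => C c c / 2 - c / 2) ⁻¹' {0} with hK
  have hmem : ∀ c, c ∈ K ↔ c ∈ Icc (0:ℝ) 1 ∧ C c c = c := by
    intro c
    simp only [hK, mem_inter_iff, mem_preimage, mem_singleton_iff]
    refine and_congr_right fun _ => ⟨fun h => by linarith, fun h => by linarith⟩
  have hKc : IsCompact K := isCompact_Icc.of_isClosed_subset hcl inter_subset_left
  obtain ⟨a, ha, ha'⟩ := (hKc.inter_right (isClosed_Iic (a := u))).exists_isGreatest
    ⟨0, (hmem 0).2 ⟨m0, (hC.1 0 m0).1⟩, hu.1⟩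
  obtain ⟨b, hb, hb'⟩ := (hKc.inter_right (isClosed_Ici (a := u))).exists_isLeast
    ⟨1, (hmem 1).2 ⟨m1, (hC.1 1 m1).2⟩, hu.2⟩
  have ha1 := (hmem a).1 ha.1
  have hb1 := (hmem b).1 hb.1
  have hau : a ≠ u := by rintro rfl; exact h ha1.2
  have hub : u ≠ b := by rintro rfl; exact h hb1.2
  refine ⟨a, b, ha1.1, hb1.1, ha1.2, hb1.2, lt_of_le_of_ne ha.2 hau, lt_of_le_of_ne hb.2 hub, ?_⟩
  intro c hc hcc
  have hcK : c ∈ K := (hmem c).2 ⟨⟨by linarith [ha1.1.1, hc.1], by linarith [hb1.1.2, hc.2]⟩, hcc⟩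
  rcases le_total c u with h1 | h1
  · exact absurd (ha' ⟨hcK, h1⟩) (not_le.2 hc.1)
  · exact absurd (hb' ⟨hcK, h1⟩) (not_le.2 hc.2)

lemma affine_lim {C E : ℝ → ℝ → ℝ} (hC : IsCopula C) (hCs : StochIncr C) (hE : IsCopula E)
    {v : ℝ} (hv : v ∈ Icc (0:ℝ) 1)
    (hT : ∀ u ∈ Icc (0:ℝ) 1, Tendsto (fun n => markovIter C n u v) atTop (nhds (E u v)))
    {a b : ℝ} (ha : a ∈ Icc (0:ℝ) 1) (hb : b ∈ Icc (0:ℝ) 1)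
    (hab : ∀ c ∈ Ioo a b, C c c ≠ c) {x : ℝ} (hx : x ∈ Ioo a b) :
    (b - a) * E x v = (b - x) * E a v + (x - a) * E b v := by
  have m1 : (1:ℝ) ∈ Icc (0:ℝ) 1 := by simp
  have hsub : ∀ c ∈ Icc a b, c ∈ Icc (0:ℝ) 1 := fun c hc =>
    ⟨ha.1.trans hc.1, hc.2.trans hb.2⟩
  have hex := fun n => exists_gamma ((iter_prop hC hCs n).1.lip1 hv) ((iter_prop hC hCs n).2 v hv)
  choose γ hγ hγb hγe using hex
  have base : ∀ s u, s ∈ Icc (0:ℝ) 1 → u ∈ Icc (0:ℝ) 1 → s ≤ u → C u s < s →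
      Tendsto (fun n => γ n s - γ n u) atTop (nhds 0) := by
    intro s u hs hu hsu hlt
    have hpos : 0 < s - C u s := by linarith
    have t1 : Tendsto (fun n => (markovIter C n u v - markovIter C (n+1) u v) / (s - C u s))
        atTop (nhds 0) := by
      have := ((hT u hu).sub ((hT u hu).comp (tendsto_add_atTop_nat 1))).div_const (s - C u s)
      simpa using this
    refine squeeze_zero (fun n => sub_nonneg.2 (hγ n hsu)) (fun n => ?_) t1
    rw [le_div_iff₀ hpos, mul_comm]
    exact mp_key hC (iter_prop hC hCs n).1 hv (hγ n) (hγb n) (hγe n) hs.1 hsu hu.2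
  have hP : ∀ s ∈ Ioo a b, ∀ u ∈ Ioo a b, Tendsto (fun n => γ n s - γ n u) atTop (nhds 0) := by
    intro s hs u hu
    refine isPreconnected_Ioo.induction₂ (fun s u => Tendsto (fun n => γ n s - γ n u) atTop (nhds 0))
      ?_ ?_ ?_ hs hu
    · intro c hc
      have hcI := hsub c (Ioo_subset_Icc_self hc)
      have hlt : C c c < c := by
        refine lt_of_le_of_ne ?_ (hab c hc)
        have a2 := (hC.lip1 hcI c hcI 1 m1 hcI.2).1
        have := (hC.2.1 c hcI).2
        dsimp only at a2
        linarith
      have hnear : ∀ᶠ y in nhds c, y ∈ Ioo (C c c) (2 * c - C c c) :=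
        Ioo_mem_nhds hlt (by linarith)
      filter_upwards [self_mem_nhdsWithin, nhdsWithin_le_nhds hnear] with y hy hy'
      have hyI := hsub y (Ioo_subset_Icc_self hy)
      rcases le_total c y with h | h
      · apply base c y hcI hyI h
        have := (hC.lip1 hcI c hcI y hyI h).2
        dsimp only at this
        linarith [hy'.2]
      · have h3 := base y c hyI hcI h (by
          have := (hC.lip2 hcI y hyI c hcI h).1
          dsimp only at this
          linarith [hy'.1])
        have h4 := h3.neg
        simpa using h4
    · intro p q r _ _ _ h1 h2
      have := h1.add h2
      simpa using this
    · intro p q _ _ h1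
      have := h1.neg
      simpa using this
  have main : ∀ s ∈ Ioo a x, ∀ u ∈ Ioo x b,
      (u - s) * E x v = (u - x) * E s v + (x - s) * E u v := by
    intro s hs u hu
    have hsI := hsub s ⟨hs.1.le, (hs.2.trans hx.2).le⟩
    have huI := hsub u ⟨(hx.1.trans hu.1).le, hu.2.le⟩
    have hxI := hsub x ⟨hx.1.le, hx.2.le⟩
    have hlim := (((hT x hxI).const_mul (u - s)).sub ((hT s hsI).const_mul (u - x))).sub
      ((hT u huI).const_mul (x - s))
    have hg := (hP s ⟨hs.1, hs.2.trans hx.2⟩ u ⟨hx.1.trans hu.1, hu.2⟩).const_mul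
      ((u - x) * (x - s))
    rw [mul_zero] at hg
    have h0 : Tendsto (fun n => (u - s) * markovIter C n x v - (u - x) * markovIter C n s v -
        (x - s) * markovIter C n u v) atTop (nhds 0) := by
      have p1 : 0 < u - x := by linarith [hu.1]
      have p2 : 0 < x - s := by linarith [hs.2]
      refine squeeze_zero (fun n => ?_) (fun n => ?_) hg
      · have g1 := gamma_bd (iter_prop hC hCs n).1 hv (hγ n) (hγe n) hsI hxI hs.2.le
        have g2 := gamma_bd (iter_prop hC hCs n).1 hv (hγ n) (hγe n) hxI huI hu.1.le
        have q1 := mul_le_mul_of_nonneg_left g1.1 p1.le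
        have q2 := mul_le_mul_of_nonneg_left g2.2 p2.le
        linarith
      · have g1 := gamma_bd (iter_prop hC hCs n).1 hv (hγ n) (hγe n) hsI hxI hs.2.le
        have g2 := gamma_bd (iter_prop hC hCs n).1 hv (hγ n) (hγe n) hxI huI hu.1.le
        have q1 := mul_le_mul_of_nonneg_left g1.2 p1.le
        have q2 := mul_le_mul_of_nonneg_left g2.1 p2.le
        linarith
    have := tendsto_nhds_unique hlim h0
    linarith
  have hcE : ContinuousOn (fun u => E u v) (Icc 0 1) := (hE.lip1 hv).lip.continuousOn
  have step1 : ∀ u ∈ Ioo x b, (u - a) * E x v = (u - x) * E a v + (x - a) * E u v := by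
    intro u hu
    have : EqOn (fun s => (u - s) * E x v) (fun s => (u - x) * E s v + (x - s) * E u v)
        (Icc a x) := by
      refine EqOn.of_subset_closure (s := Ioo a x) (fun s hs => main s hs u hu)
        (by fun_prop) ?_ Ioo_subset_Icc_self (by rw [closure_Ioo hx.1.ne])
      have hh : ContinuousOn (fun u => E u v) (Icc a x) :=
        hcE.mono fun c hc => hsub c ⟨hc.1, hc.2.trans hx.2.le⟩
      fun_prop
    exact this ⟨le_rfl, hx.1.le⟩
  have : EqOn (fun u => (u - a) * E x v) (fun u => (u - x) * E a v + (x - a) * E u v)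
      (Icc x b) := by
    refine EqOn.of_subset_closure (s := Ioo x b) (fun u hu => step1 u hu)
      (by fun_prop) ?_ Ioo_subset_Icc_self (by rw [closure_Ioo hx.2.ne])
    have hh : ContinuousOn (fun u => E u v) (Icc x b) :=
      hcE.mono fun c hc => hsub c ⟨hx.1.le.trans hc.1, hc.2⟩
    fun_prop
  exact this ⟨hx.2.le, le_rfl⟩

theorem markovIter_tendsto_ordinalSumPi (C : ℝ → ℝ → ℝ) (hC : IsCopula C)
    (hSI : StochIncr C) :
    ∃ Cstar : ℝ → ℝ → ℝ, IsCopula Cstar ∧ StochIncr Cstar ∧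
      (∀ u ∈ Icc (0:ℝ) 1, ∀ v ∈ Icc (0:ℝ) 1,
        MarkovProduct Cstar Cstar u v = Cstar u v) ∧
      IsOrdinalSumOfPi Cstar ∧
      ∀ u ∈ Icc (0:ℝ) 1, ∀ v ∈ Icc (0:ℝ) 1,
        (Antitone fun n => markovIter C n u v) ∧
        Tendsto (fun n => markovIter C n u v) atTop (nhds (Cstar u v)) := by
  have m0 : (0:ℝ) ∈ Icc (0:ℝ) 1 := by simp
  have m1 : (1:ℝ) ∈ Icc (0:ℝ) 1 := by simp
  have hA : ∀ u ∈ Icc (0:ℝ) 1, ∀ v ∈ Icc (0:ℝ) 1, Antitone fun n => markovIter C n u v :=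
    fun u hu v hv => antitone_nat_of_succ_le fun n =>
      mp_le hC (iter_prop hC hSI n).1 (iter_prop hC hSI n).2 hu hv
  set E : ℝ → ℝ → ℝ := fun u v => ⨅ n, markovIter C n u v with hEdef
  have hT : ∀ u ∈ Icc (0:ℝ) 1, ∀ v ∈ Icc (0:ℝ) 1,
      Tendsto (fun n => markovIter C n u v) atTop (nhds (E u v)) := by
    intro u hu v hv
    refine tendsto_atTop_ciInf (hA u hu v hv) ⟨0, ?_⟩
    rintro _ ⟨n, rfl⟩
    have hD := (iter_prop hC hSI n).1
    have a1 := (hD.lip1 hv 0 m0 u hu hu.1).1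
    have := (hD.2.1 v hv).1
    dsimp only at *
    linarith
  have hE : IsCopula E := by
    refine ⟨fun u hu => ⟨?_, ?_⟩, fun v hv => ⟨?_, ?_⟩, ?_⟩
    · exact tendsto_nhds_unique (hT u hu 0 m0) (by
        simp only [fun n => ((iter_prop hC hSI n).1.1 u hu).1]; exact tendsto_const_nhds)
    · exact tendsto_nhds_unique (hT u hu 1 m1) (by
        simp only [fun n => ((iter_prop hC hSI n).1.1 u hu).2]; exact tendsto_const_nhds)
    · exact tendsto_nhds_unique (hT 0 m0 v hv) (by
        simp only [fun n => ((iter_prop hC hSI n).1.2.1 v hv).1]; exact tendsto_const_nhds)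
    · exact tendsto_nhds_unique (hT 1 m1 v hv) (by
        simp only [fun n => ((iter_prop hC hSI n).1.2.1 v hv).2]; exact tendsto_const_nhds)
    · intro u₁ u₂ v₁ v₂ hu₁ hu₂ hv₁ hv₂ hu hv
      exact ge_of_tendsto' ((((hT u₂ hu₂ v₂ hv₂).sub (hT u₂ hu₂ v₁ hv₁)).sub
        (hT u₁ hu₁ v₂ hv₂)).add (hT u₁ hu₁ v₁ hv₁)) fun n =>
        (iter_prop hC hSI n).1.2.2 u₁ u₂ v₁ v₂ hu₁ hu₂ hv₁ hv₂ hu hv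
  have hEs : StochIncr E := by
    intro v hv
    refine ⟨convex_Icc 0 1, ?_⟩
    intro x hx y hy a b ha hb hab
    have hz : a • x + b • y ∈ Icc (0:ℝ) 1 := convex_Icc (0:ℝ) 1 hx hy ha hb hab
    exact le_of_tendsto_of_tendsto' (((hT x hx v hv).const_smul a).add
      ((hT y hy v hv).const_smul b)) (hT _ hz v hv) fun n =>
      ((iter_prop hC hSI n).2 v hv).2 hx hy ha hb hab
  have hfix : ∀ c ∈ Icc (0:ℝ) 1, C c c = c → ∀ v ∈ Icc (0:ℝ) 1, E c v = min c v := by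
    intro c hc h v hv
    exact tendsto_nhds_unique (hT c hc v hv) (by
      simp only [fun n => iter_fix hC hSI hc h hv n]; exact tendsto_const_nhds)
  have hint : ∀ a ∈ Icc (0:ℝ) 1, ∀ b ∈ Icc (0:ℝ) 1, C a a = a → C b b = b →
      (∀ c ∈ Ioo a b, C c c ≠ c) → ∀ u ∈ Ioo a b, ∀ v ∈ Icc (0:ℝ) 1,
      E u v = (b - u) / (b - a) * min a v + (u - a) / (b - a) * min b v := by
    intro a ha b hb hfa hfb hab u hu v hv
    have := affine_lim hC hSI hE hv (fun u hu => hT u hu v hv) ha hb hab hu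
    rw [hfix a ha hfa v hv, hfix b hb hfb v hv] at this
    have hne : b - a ≠ 0 := by linarith [hu.1, hu.2]
    field_simp
    linarith
  refine ⟨E, hE, hEs, ?_, ?_, fun u hu v hv => ⟨hA u hu v hv, hT u hu v hv⟩⟩
  · intro u hu v hv
    by_cases h : C u u = u
    · have : MarkovProduct E E u v = 1 * E u v + 0 * E u v :=
        mp_min hu hu (fun t ht => by rw [hfix u hu h t ht]; ring) (hE.lip1 hv) (hE.2.1 v hv).1
      rw [this]; ring
    · obtain ⟨a, b, ha, hb, hfa, hfb, hau, hub, hno⟩ := exists_comp hC hu h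
      have hi := hint a ha b hb hfa hfb hno u ⟨hau, hub⟩
      have : MarkovProduct E E u v = (b - u) / (b - a) * E a v + (u - a) / (b - a) * E b v :=
        mp_min ha hb hi (hE.lip1 hv) (hE.2.1 v hv).1
      rw [this, hfix a ha hfa v hv, hfix b hb hfb v hv, hi v hv]
  · set I : Set (ℝ × ℝ) := {p | p.1 ∈ Icc (0:ℝ) 1 ∧ p.2 ∈ Icc (0:ℝ) 1 ∧ C p.1 p.1 = p.1 ∧
      C p.2 p.2 = p.2 ∧ p.1 < p.2 ∧ ∀ c ∈ Ioo p.1 p.2, C c c ≠ c} with hI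
    have hdisj : I.PairwiseDisjoint fun p => Ioo p.1 p.2 := by
      rintro ⟨a, b⟩ ⟨_, _, ha, hb, hab, hno⟩ ⟨a', b'⟩ ⟨_, _, ha', hb', hab', hno'⟩ hne
      rw [Function.onFun, Set.disjoint_left]
      intro x hx hx'
      dsimp only at *
      apply hne
      have e1 : a = a' := by
        rcases lt_trichotomy a a' with h | h | h
        · exact absurd ha' (hno a' ⟨h, hx'.1.trans hx.2⟩)
        · exact h
        · exact absurd ha (hno' a ⟨h, hx.1.trans hx'.2⟩)
      have e2 : b = b' := by
        rcases lt_trichotomy b b' with h | h | h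
        · exact absurd hb (hno' b ⟨hx'.1.trans hx.2, h⟩)
        · exact h
        · exact absurd hb' (hno b' ⟨hx.1.trans hx'.2, h⟩)
      rw [e1, e2]
    refine ⟨I, hdisj.countable_of_isOpen (fun _ _ => isOpen_Ioo)
      (fun p hp => nonempty_Ioo.2 hp.2.2.2.2.1), fun p hp => ⟨hp.1.1, hp.2.2.2.2.1, hp.2.1.2⟩,
      hdisj, ?_⟩
    intro u hu v hv
    constructor
    · rintro ⟨a, b⟩ ⟨ha, hb, hfa, hfb, hab, hno⟩ hu' hv'
      dsimp only at *
      rw [hint a ha b hb hfa hfb hno u hu' v hv, min_eq_left hv'.1.le, min_eq_right hv'.2.le]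
      have hne : b - a ≠ 0 := by linarith
      field_simp
      ring
    · intro hn
      by_cases h : C u u = u
      · exact hfix u hu h v hv
      · obtain ⟨a, b, ha, hb, hfa, hfb, hau, hub, hno⟩ := exists_comp hC hu h
        rw [hint a ha b hb hfa hfb hno u ⟨hau, hub⟩ v hv]
        have hne : b - a ≠ 0 := by linarith
        by_cases h1 : v ≤ a
        · rw [min_eq_right h1, min_eq_right (by linarith), min_eq_right (by linarith)]
          field_simp
          ring
        · by_cases h2 : b ≤ v
          · rw [min_eq_left (by linarith), min_eq_left h2, min_eq_left (by linarith)]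
            field_simp
            ring
          · exact absurd ⟨(a, b), ⟨ha, hb, hfa, hfb, hau.trans hub, hno⟩, ⟨hau, hub⟩,
              ⟨not_le.1 h1, not_le.1 h2⟩⟩ hn
end

section
/- For any two 2-copulas C₁ and C₂, the Markov product (C₁ * C₂)(u,v) = ∫₀¹ ∂₂C₁(u,t) ∂₁C₂(t,v) dt is again a 2-copula, and the corresponding Markov operators satisfy T_{C₁ * C₂} = T_{C₁} ∘ T_{C₂}. -/
open MeasureTheory Set Filter

/-- The Markov operator associated to a copula: T_C f (u) = ∂_u ∫₀¹ ∂_v C(u,v) f(v) dv. -/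
noncomputable def MarkovOp (C : ℝ → ℝ → ℝ) (f : ℝ → ℝ) (u : ℝ) : ℝ :=
  deriv (fun x => ∫ v in (0:ℝ)..1, deriv (fun w => C x w) v * f v) u

namespace CopAux

noncomputable abbrev lam : Measure ℝ := volume.restrict (Ioc (0:ℝ) 1)

def ML (h : ℝ → ℝ) : Prop :=
  ∀ x y : ℝ, x ∈ Icc (0:ℝ) 1 → y ∈ Icc (0:ℝ) 1 → x ≤ y → 0 ≤ h y - h x ∧ h y - h x ≤ y - x

lemma ae_Ioo : ∀ᵐ t ∂lam, t ∈ Ioo (0:ℝ) 1 := by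
  have : lam = volume.restrict (Ioo (0:ℝ) 1) := (Measure.restrict_congr_set Ioo_ae_eq_Ioc).symm
  rw [this]
  exact ae_restrict_mem measurableSet_Ioo

lemma intI (f : ℝ → ℝ) : ∫ t in (0:ℝ)..1, f t = ∫ t, f t ∂lam :=
  intervalIntegral.integral_of_le zero_le_one

lemma ML.lip {h : ℝ → ℝ} (hh : ML h) : LipschitzOnWith 1 h (Icc 0 1) := by
  apply LipschitzOnWith.of_dist_le_mul
  intro x hx y hy
  rw [Real.dist_eq, Real.dist_eq, NNReal.coe_one, one_mul]
  rcases le_total x y with hxy | hxy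
  · have := hh x y hx hy hxy
    rw [abs_sub_comm, abs_sub_comm x y, abs_of_nonneg this.1, abs_of_nonneg (by linarith)]
    exact this.2
  · have := hh y x hy hx hxy
    rw [abs_of_nonneg this.1, abs_of_nonneg (by linarith)]
    exact this.2

lemma ML.ac {h : ℝ → ℝ} (hh : ML h) {a b : ℝ} (ha : a ∈ Icc (0:ℝ) 1) (hb : b ∈ Icc (0:ℝ) 1) :
    AbsolutelyContinuousOnInterval h a b := by
  apply LipschitzOnWith.absolutelyContinuousOnInterval (K := 1)
  apply hh.lip.mono
  exact uIcc_subset_Icc ha hb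

lemma ML.diff {h : ℝ → ℝ} (hh : ML h) : ∀ᵐ t ∂lam, DifferentiableAt ℝ h t := by
  have := (hh.ac (a := 0) (b := 1) (by simp) (by simp)).ae_differentiableAt
  filter_upwards [ae_restrict_of_ae this, ae_Ioo] with t h1 h2
  apply h1
  rw [uIcc_of_le zero_le_one]
  exact Ioo_subset_Icc_self h2

lemma deriv_nonneg_of_mono {h : ℝ → ℝ} (hh : MonotoneOn h (Icc 0 1)) {t : ℝ}
    (ht : t ∈ Ioo (0:ℝ) 1) : 0 ≤ deriv h t := by
  rw [← derivWithin_of_mem_nhds (Icc_mem_nhds ht.1 ht.2)]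
  exact hh.derivWithin_nonneg

lemma ML.monotoneOn {h : ℝ → ℝ} (hh : ML h) : MonotoneOn h (Icc 0 1) := by
  intro x hx y hy hxy
  linarith [(hh x y hx hy hxy).1]

lemma ML.deriv_nonneg {h : ℝ → ℝ} (hh : ML h) {t : ℝ} (ht : t ∈ Ioo (0:ℝ) 1) :
    0 ≤ deriv h t := deriv_nonneg_of_mono hh.monotoneOn ht

lemma ML.deriv_le {h : ℝ → ℝ} (hh : ML h) {t : ℝ} (ht : t ∈ Ioo (0:ℝ) 1) :
    deriv h t ≤ 1 := by
  have := norm_deriv_le_of_lipschitzOn (Icc_mem_nhds ht.1 ht.2) hh.lip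
  exact (le_abs_self _).trans (by simpa using this)

lemma ML.deriv_ae {h : ℝ → ℝ} (hh : ML h) :
    ∀ᵐ t ∂lam, 0 ≤ deriv h t ∧ deriv h t ≤ 1 := by
  filter_upwards [ae_Ioo] with t ht
  exact ⟨hh.deriv_nonneg ht, hh.deriv_le ht⟩

lemma ML.integral {h : ℝ → ℝ} (hh : ML h) {a b : ℝ} (ha : a ∈ Icc (0:ℝ) 1)
    (hb : b ∈ Icc (0:ℝ) 1) : ∫ t in a..b, deriv h t = h b - h a :=
  (hh.ac ha hb).integral_deriv_eq_sub

lemma ML.integral01 {h : ℝ → ℝ} (hh : ML h) : ∫ t, deriv h t ∂lam = h 1 - h 0 := by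
  rw [← intI]; exact hh.integral (by simp) (by simp)

lemma integrable_bdd {f : ℝ → ℝ} (hf : Measurable f) (hb : ∀ᵐ t ∂lam, 0 ≤ f t ∧ f t ≤ 1) :
    Integrable f lam := by
  apply Integrable.of_bound hf.aestronglyMeasurable 1
  filter_upwards [hb] with t ht
  rw [Real.norm_eq_abs, abs_of_nonneg ht.1]; exact ht.2

lemma integrable_mul {φ g : ℝ → ℝ} (hφ : Measurable φ) (hb : ∀ᵐ t ∂lam, 0 ≤ φ t ∧ φ t ≤ 1)
    (hg : Integrable g lam) : Integrable (fun t => φ t * g t) lam := by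
  apply hg.bdd_mul hφ.aestronglyMeasurable (c := 1)
  filter_upwards [hb] with t ht
  rw [Real.norm_eq_abs, abs_of_nonneg ht.1]; exact ht.2

lemma ML.deriv_int {h : ℝ → ℝ} (hh : ML h) : Integrable (deriv h) lam :=
  integrable_bdd (measurable_deriv h) hh.deriv_ae

lemma swap {C : ℝ → ℝ → ℝ} (h : IsCopula C) : IsCopula (fun u v => C v u) := by
  refine ⟨h.2.1, h.1, ?_⟩
  intro u₁ u₂ v₁ v₂ a b c d e f
  have := h.2.2 v₁ v₂ u₁ u₂ c d a b f e
  linarith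

lemma ml1 {C : ℝ → ℝ → ℝ} (h : IsCopula C) {v : ℝ} (hv : v ∈ Icc (0:ℝ) 1) :
    ML (fun u => C u v) := by
  intro x y hx hy hxy
  have h0 : (0:ℝ) ∈ Icc (0:ℝ) 1 := by simp
  have h1 : (1:ℝ) ∈ Icc (0:ℝ) 1 := by simp
  have a := h.2.2 x y 0 v hx hy h0 hv hxy hv.1
  have b := h.2.2 x y v 1 hx hy hv h1 hxy hv.2
  have c := h.1 x hx
  have d := h.1 y hy
  constructor <;> simp only <;> linarith

lemma ml2 {C : ℝ → ℝ → ℝ} (h : IsCopula C) {u : ℝ} (hu : u ∈ Icc (0:ℝ) 1) :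
    ML (fun v => C u v) := ml1 (swap h) hu

lemma mono1 {C : ℝ → ℝ → ℝ} (h : IsCopula C) {a b : ℝ} (ha : a ∈ Icc (0:ℝ) 1)
    (hb : b ∈ Icc (0:ℝ) 1) (hab : a ≤ b) :
    ∀ᵐ t ∂lam, deriv (fun s => C s a) t ≤ deriv (fun s => C s b) t := by
  filter_upwards [(ml1 h ha).diff, (ml1 h hb).diff, ae_Ioo] with t h1 h2 h3
  have := deriv_nonneg_of_mono (h := fun s => C s b - C s a) (by
    intro x hx y hy hxy
    have := h.2.2 x y a b hx hy ha hb hxy hab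
    simp only; linarith) h3
  rw [deriv_fun_sub h2 h1] at this
  linarith

lemma d1_zero {C : ℝ → ℝ → ℝ} (h : IsCopula C) :
    ∀ᵐ t ∂lam, deriv (fun s => C s 0) t = 0 := by
  filter_upwards [ae_Ioo] with t ht
  have : (fun s => C s 0) =ᶠ[nhds t] fun _ => (0:ℝ) := by
    filter_upwards [Icc_mem_nhds ht.1 ht.2] with s hs using (h.1 s hs).1
  rw [this.deriv_eq]; simp

lemma d1_one {C : ℝ → ℝ → ℝ} (h : IsCopula C) :
    ∀ᵐ t ∂lam, deriv (fun s => C s 1) t = 1 := by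
  filter_upwards [ae_Ioo] with t ht
  have : (fun s => C s 1) =ᶠ[nhds t] fun s => s := by
    filter_upwards [Icc_mem_nhds ht.1 ht.2] with s hs using (h.1 s hs).2
  rw [this.deriv_eq]; simp

lemma int_d1 {C : ℝ → ℝ → ℝ} (h : IsCopula C) {v : ℝ} (hv : v ∈ Icc (0:ℝ) 1) :
    ∫ t, deriv (fun s => C s v) t ∂lam = v := by
  rw [(ml1 h hv).integral01, (h.2.1 v hv).1, (h.2.1 v hv).2, sub_zero]

lemma psi_zero {C : ℝ → ℝ → ℝ} (h : IsCopula C) (φ : ℝ → ℝ) :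
    ∫ t, φ t * deriv (fun s => C s 0) t ∂lam = 0 := by
  rw [integral_congr_ae (g := fun _ => (0:ℝ))]
  · simp
  · filter_upwards [d1_zero h] with t ht
    rw [ht, mul_zero]

lemma psi_one {C : ℝ → ℝ → ℝ} (h : IsCopula C) (φ : ℝ → ℝ) :
    ∫ t, φ t * deriv (fun s => C s 1) t ∂lam = ∫ t, φ t ∂lam := by
  apply integral_congr_ae
  filter_upwards [d1_one h] with t ht
  rw [ht, mul_one]

lemma psi_ml {C : ℝ → ℝ → ℝ} (h : IsCopula C) {φ : ℝ → ℝ} (hφ : Measurable φ)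
    (hb : ∀ᵐ t ∂lam, 0 ≤ φ t ∧ φ t ≤ 1) :
    ML (fun v => ∫ t, φ t * deriv (fun s => C s v) t ∂lam) := by
  intro x y hx hy hxy
  have ix := integrable_mul hφ hb (ml1 h hx).deriv_int
  have iy := integrable_mul hφ hb (ml1 h hy).deriv_int
  simp only
  constructor
  · rw [sub_nonneg]
    apply integral_mono_ae ix iy
    filter_upwards [hb, mono1 h hx hy hxy] with t h1 h2
    exact mul_le_mul_of_nonneg_left h2 h1.1
  · rw [← integral_sub iy ix]
    calc _ ≤ ∫ t, (deriv (fun s => C s y) t - deriv (fun s => C s x) t) ∂lam := by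
          apply integral_mono_ae (iy.sub ix) ((ml1 h hy).deriv_int.sub (ml1 h hx).deriv_int)
          filter_upwards [hb, mono1 h hx hy hxy] with t h1 h2
          simp only [Pi.sub_apply]
          nlinarith
      _ = y - x := by
          rw [integral_sub (ml1 h hy).deriv_int (ml1 h hx).deriv_int, int_d1 h hy, int_d1 h hx]

lemma prod_eq (C₁ C₂ : ℝ → ℝ → ℝ) (u v : ℝ) : MarkovProduct C₁ C₂ u v =
    ∫ t, deriv (fun s => C₁ u s) t * deriv (fun s => C₂ s v) t ∂lam := intI _

lemma four {f g h k : ℝ → ℝ} (hf : Integrable f lam) (hg : Integrable g lam)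
    (hh : Integrable h lam) (hk : Integrable k lam) (H : ∀ᵐ t ∂lam, 0 ≤ f t - g t - h t + k t) :
    0 ≤ ∫ t, f t ∂lam - ∫ t, g t ∂lam - ∫ t, h t ∂lam + ∫ t, k t ∂lam := by
  have e : 0 ≤ ∫ t, (f - g - h + k) t ∂lam := integral_nonneg_of_ae H
  rw [integral_add' ((hf.sub hg).sub hh) hk, integral_sub' (hf.sub hg) hh,
    integral_sub' hf hg] at e
  exact e

lemma prod_copula {C₁ C₂ : ℝ → ℝ → ℝ} (h₁ : IsCopula C₁) (h₂ : IsCopula C₂) :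
    IsCopula (MarkovProduct C₁ C₂) := by
  refine ⟨?_, ?_, ?_⟩
  · intro u hu
    rw [prod_eq, prod_eq, psi_zero h₂, psi_one h₂]
    exact ⟨rfl, int_d1 (swap h₁) hu⟩
  · intro v hv
    rw [prod_eq, prod_eq]
    simp_rw [mul_comm (deriv (fun s => C₁ _ s) _)]
    have a := psi_zero (swap h₁) (deriv (fun s => C₂ s v))
    have b := psi_one (swap h₁) (deriv (fun s => C₂ s v))
    rw [a, b]
    exact ⟨rfl, int_d1 h₂ hv⟩
  · intro u₁ u₂ v₁ v₂ hu₁ hu₂ hv₁ hv₂ hu hv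
    simp only [prod_eq]
    have I : ∀ u ∈ Icc (0:ℝ) 1, ∀ v ∈ Icc (0:ℝ) 1, Integrable (fun t =>
        deriv (fun s => C₁ u s) t * deriv (fun s => C₂ s v) t) lam := fun u hu v hv =>
      integrable_mul (measurable_deriv _) (ml2 h₁ hu).deriv_ae (ml1 h₂ hv).deriv_int
    apply four (I _ hu₂ _ hv₂) (I _ hu₂ _ hv₁) (I _ hu₁ _ hv₂) (I _ hu₁ _ hv₁)
    filter_upwards [mono1 h₂ hv₁ hv₂ hv, mono1 (swap h₁) hu₁ hu₂ hu] with t a b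
    nlinarith [mul_nonneg (sub_nonneg.2 a) (sub_nonneg.2 b)]

open scoped ENNReal

def Pair (C : ℝ → ℝ → ℝ) (φ σ : ℝ → ℝ≥0∞) : Prop :=
  Measurable φ ∧ Measurable σ ∧ (∫⁻ t, σ t ∂lam ≠ ∞) ∧ ∀ a ∈ Icc (0:ℝ) 1,
    ∫⁻ t, φ t * ENNReal.ofReal (deriv (fun s => C s a) t) ∂lam = ∫⁻ t in Iic a, σ t ∂lam

lemma lam_Iic {a : ℝ} (ha : a ∈ Icc (0:ℝ) 1) :
    lam.restrict (Iic a) = volume.restrict (Ioc 0 a) := by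
  rw [Measure.restrict_restrict measurableSet_Iic]
  congr 1
  ext x
  simp only [mem_inter_iff, mem_Iic, mem_Ioc]
  constructor
  · rintro ⟨h1, h2, h3⟩; exact ⟨h2, h1⟩
  · rintro ⟨h1, h2⟩; exact ⟨h2, h1, h2.trans ha.2⟩

lemma pair_of_real {C : ℝ → ℝ → ℝ} (h : IsCopula C) {φ σ : ℝ → ℝ} (hφ : Measurable φ)
    (hφb : ∀ᵐ t ∂lam, 0 ≤ φ t ∧ φ t ≤ 1) (hσ : Measurable σ)
    (hσb : ∀ᵐ t ∂lam, 0 ≤ σ t ∧ σ t ≤ 1)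
    (H : ∀ a ∈ Icc (0:ℝ) 1, ∫ t, φ t * deriv (fun s => C s a) t ∂lam = ∫ t in (0:ℝ)..a, σ t) :
    Pair C (fun t => ENNReal.ofReal (φ t)) (fun t => ENNReal.ofReal (σ t)) := by
  have iσ := integrable_bdd hσ hσb
  refine ⟨hφ.ennreal_ofReal, hσ.ennreal_ofReal, ?_, ?_⟩
  · rw [← ofReal_integral_eq_lintegral_ofReal iσ (hσb.mono fun t ht => ht.1)]
    exact ENNReal.ofReal_ne_top
  · intro a ha
    have e1 : ∫⁻ t, ENNReal.ofReal (φ t) * ENNReal.ofReal (deriv (fun s => C s a) t) ∂lam =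
        ∫⁻ t, ENNReal.ofReal (φ t * deriv (fun s => C s a) t) ∂lam := by
      apply lintegral_congr_ae
      filter_upwards [hφb] with t ht
      rw [ENNReal.ofReal_mul ht.1]
    rw [e1, ← ofReal_integral_eq_lintegral_ofReal
      (integrable_mul hφ hφb (ml1 h ha).deriv_int), H a ha,
      ← ofReal_integral_eq_lintegral_ofReal iσ.restrict
      (ae_restrict_of_ae (hσb.mono fun t ht => ht.1)), lam_Iic ha,
      intervalIntegral.integral_of_le ha.1]
    filter_upwards [hφb, (ml1 h ha).deriv_ae] with t h1 h2
    exact mul_nonneg h1.1 h2.1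

lemma psi_int {C : ℝ → ℝ → ℝ} (h : IsCopula C) {φ : ℝ → ℝ} (hφ : Measurable φ)
    (hb : ∀ᵐ t ∂lam, 0 ≤ φ t ∧ φ t ≤ 1) : ∀ a ∈ Icc (0:ℝ) 1,
    ∫ t, φ t * deriv (fun s => C s a) t ∂lam =
      ∫ t in (0:ℝ)..a, deriv (fun v => ∫ t, φ t * deriv (fun s => C s v) t ∂lam) t := by
  intro a ha
  rw [(psi_ml h hφ hb).integral (by simp) ha, psi_zero h, sub_zero]

lemma pair_one {C : ℝ → ℝ → ℝ} (h : IsCopula C) {φ σ : ℝ → ℝ≥0∞} (H : Pair C φ σ) :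
    ∫⁻ t, φ t ∂lam = ∫⁻ t, σ t ∂lam := by
  have := H.2.2.2 1 (by simp)
  rw [lam_Iic (by simp)] at this
  rw [← this]
  apply lintegral_congr_ae
  filter_upwards [d1_one h] with t ht
  rw [ht]; simp

lemma pair_exists {C : ℝ → ℝ → ℝ} (h : IsCopula C) {A : Set ℝ} (hA : MeasurableSet A) :
    ∃ σ, Pair C (A.indicator 1) σ := by
  have hφ : Measurable (A.indicator (1 : ℝ → ℝ)) := measurable_one.indicator hA
  have hb : ∀ᵐ t ∂lam, 0 ≤ A.indicator (1 : ℝ → ℝ) t ∧ A.indicator (1 : ℝ → ℝ) t ≤ 1 := by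
    refine ae_of_all _ fun t => ?_
    by_cases ht : t ∈ A <;> simp [ht]
  have := pair_of_real h hφ hb (measurable_deriv _) (psi_ml h hφ hb).deriv_ae (psi_int h hφ hb)
  have e : (fun t => ENNReal.ofReal (A.indicator (1 : ℝ → ℝ) t)) = A.indicator 1 := by
    ext t
    by_cases ht : t ∈ A <;> simp [ht]
  rw [e] at this
  exact ⟨_, this⟩

lemma mm {f g : ℝ → ℝ≥0∞} (hf : Measurable f) (hg : Measurable g) :
    Measurable (fun t => f t * g t) := hf.mul hg

def Q (C : ℝ → ℝ → ℝ) (f : ℝ → ℝ≥0∞) : Prop :=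
  ∃ g : ℝ → ℝ≥0∞, Measurable g ∧ ∀ φ σ, Pair C φ σ →
    ∫⁻ t, φ t * g t ∂lam = ∫⁻ t, f t * σ t ∂lam

lemma Q.tsum {C : ℝ → ℝ → ℝ} {f : ℕ → ℝ → ℝ≥0∞} (hf : ∀ n, Measurable (f n))
    (hq : ∀ n, Q C (f n)) : Q C (fun t => ∑' n, f n t) := by
  choose g hg hG using hq
  refine ⟨fun t => ∑' n, g n t, Measurable.tsum hg, ?_⟩
  intro φ σ H
  simp_rw [← ENNReal.tsum_mul_left, ← ENNReal.tsum_mul_right]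
  rw [lintegral_tsum fun n => (mm H.1 (hg n)).aemeasurable,
    lintegral_tsum fun n => (mm (hf n) H.2.1).aemeasurable]
  exact tsum_congr fun n => hG n φ σ H

lemma Q.add {C : ℝ → ℝ → ℝ} {f f' : ℝ → ℝ≥0∞} (hf : Measurable f)
    (hq : Q C f) (hq' : Q C f') : Q C (fun t => f t + f' t) := by
  obtain ⟨g, hg, hG⟩ := hq
  obtain ⟨g', hg', hG'⟩ := hq'
  refine ⟨fun t => g t + g' t, hg.add hg', ?_⟩
  intro φ σ H
  simp_rw [mul_add, add_mul]
  rw [lintegral_add_left (mm H.1 hg), lintegral_add_left (mm hf H.2.1), hG _ _ H, hG' _ _ H]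

lemma Q.const_mul {C : ℝ → ℝ → ℝ} {f : ℝ → ℝ≥0∞} (hf : Measurable f) (c : ℝ≥0∞)
    (hq : Q C f) : Q C (fun t => c * f t) := by
  obtain ⟨g, hg, hG⟩ := hq
  refine ⟨fun t => c * g t, hg.const_mul c, ?_⟩
  intro φ σ H
  simp_rw [mul_left_comm _ c, mul_assoc]
  rw [lintegral_const_mul c (mm H.1 hg), lintegral_const_mul c (mm hf H.2.1), hG _ _ H]

lemma lint_ind {A : Set ℝ} (hA : MeasurableSet A) (f : ℝ → ℝ≥0∞) :
    ∫⁻ t, A.indicator 1 t * f t ∂lam = ∫⁻ t in A, f t ∂lam := by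
  rw [← lintegral_indicator hA]
  congr 1; ext t
  by_cases ht : t ∈ A <;> simp [ht]

lemma Q.indicator {C : ℝ → ℝ → ℝ} (h : IsCopula C) (A : Set ℝ) (hA : MeasurableSet A) :
    Q C (A.indicator 1) := by
  induction A, hA using MeasurableSpace.induction_on_inter (borel_eq_generateFrom_Iic ℝ)
    isPiSystem_Iic with
  | empty => exact ⟨0, measurable_zero, by simp⟩
  | basic A hA =>
    obtain ⟨a, rfl⟩ := hA
    set b := max 0 (min a 1) with hb
    have hb1 : b ∈ Icc (0:ℝ) 1 := ⟨le_max_left _ _, max_le zero_le_one (min_le_right _ _)⟩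
    refine ⟨fun t => ENNReal.ofReal (deriv (fun s => C s b) t),
      (measurable_deriv _).ennreal_ofReal, ?_⟩
    intro φ σ H
    rw [H.2.2.2 b hb1, lint_ind measurableSet_Iic, Measure.restrict_restrict measurableSet_Iic,
      Measure.restrict_restrict measurableSet_Iic]
    congr 2
    ext x
    simp only [mem_inter_iff, mem_Iic, mem_Ioc, hb, le_max_iff, le_min_iff]
    constructor
    · rintro ⟨h1 | h1, h2, h3⟩
      · exact absurd h1 (not_le.2 h2)
      · exact ⟨h1.1, h2, h3⟩
    · rintro ⟨h1, h2, h3⟩; exact ⟨Or.inr ⟨h1, h3⟩, h2, h3⟩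
  | compl A hA ih =>
    obtain ⟨g, hg, hG⟩ := ih
    have hle : g ≤ᵐ[lam] fun _ => 1 := by
      apply ae_le_of_forall_setLIntegral_le_of_sigmaFinite hg
      intro B hB _
      obtain ⟨σ, hσ⟩ := pair_exists h hB
      rw [← lint_ind hB, ← lint_ind hB, hG _ _ hσ]
      simp only [mul_one]
      rw [pair_one h hσ, lint_ind hA]
      exact setLIntegral_le_lintegral _ _
    refine ⟨fun t => 1 - g t, measurable_const.sub hg, ?_⟩
    intro φ σ H
    have e1 : ∫⁻ t, φ t * (1 - g t) ∂lam + ∫⁻ t, φ t * g t ∂lam = ∫⁻ t, φ t ∂lam := by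
      rw [← lintegral_add_right _ (mm H.1 hg)]
      apply lintegral_congr_ae
      filter_upwards [hle] with t ht
      rw [← mul_add, tsub_add_cancel_of_le ht, mul_one]
    have e2 := lintegral_add_compl (μ := lam) σ hA
    rw [hG _ _ H, lint_ind hA, pair_one h H, ← e2, add_comm] at e1
    rw [lint_ind hA.compl]
    refine (ENNReal.add_right_inj ?_).1 e1
    exact ((setLIntegral_le_lintegral _ _).trans_lt (lt_top_iff_ne_top.2 H.2.2.1)).ne
  | iUnion f hd hf ih =>
    have := Q.tsum (fun n => measurable_one.indicator (hf n)) ih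
    convert this using 1
    ext t
    by_cases ht : t ∈ ⋃ i, f i
    · obtain ⟨i, hi⟩ := mem_iUnion.1 ht
      rw [indicator_of_mem ht, tsum_eq_single i]
      · rw [indicator_of_mem hi]
      · intro j hj
        exact indicator_of_notMem (fun h' => (hd hj).le_bot ⟨h', hi⟩) _
    · rw [indicator_of_notMem ht]
      symm
      rw [ENNReal.tsum_eq_zero]
      exact fun i => indicator_of_notMem (fun h' => ht (mem_iUnion.2 ⟨i, h'⟩)) _

lemma Q.all {C : ℝ → ℝ → ℝ} (h : IsCopula C) (f : ℝ → ℝ≥0∞) (hf : Measurable f) : Q C f := by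
  have key : ∀ s : SimpleFunc ℝ NNReal, Q C (fun t => (s t : ℝ≥0∞)) := by
    intro s
    induction s using SimpleFunc.induction with
    | const c hA =>
      convert (Q.indicator h _ hA).const_mul (measurable_one.indicator hA) (c : ℝ≥0∞) using 1
      ext t
      rename_i A
      by_cases ht : t ∈ A <;> simp [ht]
    | add hd h1 h2 =>
      convert h1.add (by fun_prop) h2 using 1
      ext t; simp
  have := Q.tsum (C := C) (f := fun n t => (SimpleFunc.eapproxDiff f n t : ℝ≥0∞))
    (fun n => by fun_prop) (fun n => key _)
  convert this using 1
  ext t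
  exact (SimpleFunc.tsum_eapproxDiff f hf t).symm

def RPair (C : ℝ → ℝ → ℝ) (φ σ : ℝ → ℝ) : Prop :=
  Measurable φ ∧ (∀ᵐ t ∂lam, 0 ≤ φ t ∧ φ t ≤ 1) ∧ Measurable σ ∧
  (∀ᵐ t ∂lam, 0 ≤ σ t ∧ σ t ≤ 1) ∧
  ∀ a ∈ Icc (0:ℝ) 1, ∫ t, φ t * deriv (fun s => C s a) t ∂lam = ∫ t in (0:ℝ)..a, σ t

lemma RPair.pair {C : ℝ → ℝ → ℝ} (h : IsCopula C) {φ σ : ℝ → ℝ} (H : RPair C φ σ) :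
    Pair C (fun t => ENNReal.ofReal (φ t)) (fun t => ENNReal.ofReal (σ t)) :=
  pair_of_real h H.1 H.2.1 H.2.2.1 H.2.2.2.1 H.2.2.2.2

lemma rpair_one {C : ℝ → ℝ → ℝ} (h : IsCopula C) : RPair C (fun _ => 1) (fun _ => 1) := by
  refine ⟨measurable_const, ae_of_all _ (by simp), measurable_const, ae_of_all _ (by simp), ?_⟩
  intro a ha
  simp [int_d1 h ha]

lemma dual_nonneg {C : ℝ → ℝ → ℝ} (h : IsCopula C) {f : ℝ → ℝ} (hf : Measurable f)
    (hf0 : ∀ t, 0 ≤ f t) (hi : Integrable f lam) :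
    ∃ g : ℝ → ℝ, Integrable g lam ∧ ∀ φ σ, RPair C φ σ →
      ∫ t, φ t * g t ∂lam = ∫ t, σ t * f t ∂lam := by
  obtain ⟨g, hg, hG⟩ := Q.all h (fun t => ENNReal.ofReal (f t)) hf.ennreal_ofReal
  have h1 := hG _ _ ((rpair_one h).pair h)
  simp only [ENNReal.ofReal_one, one_mul, mul_one] at h1
  have hfin : ∫⁻ t, g t ∂lam ≠ ∞ := by
    rw [h1, ← ofReal_integral_eq_lintegral_ofReal hi (ae_of_all _ hf0)]
    exact ENNReal.ofReal_ne_top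
  have hlt := ae_lt_top hg hfin
  have hgi := integrable_toReal_of_lintegral_ne_top hg.aemeasurable hfin
  refine ⟨fun t => (g t).toReal, hgi, ?_⟩
  intro φ σ H
  rw [integral_eq_lintegral_of_nonneg_ae, integral_eq_lintegral_of_nonneg_ae]
  · congr 1
    have := hG _ _ (H.pair h)
    rw [lintegral_congr_ae (g := fun t => ENNReal.ofReal (φ t) * g t), this]
    · apply lintegral_congr_ae
      filter_upwards [H.2.2.2.1] with t ht
      rw [ENNReal.ofReal_mul ht.1, mul_comm]
    · filter_upwards [H.2.1, hlt] with t ht h2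
      rw [ENNReal.ofReal_mul ht.1, ENNReal.ofReal_toReal h2.ne]
  · filter_upwards [H.2.2.2.1] with t ht
    exact mul_nonneg ht.1 (hf0 t)
  · exact (integrable_mul H.2.2.1 H.2.2.2.1 hi).1
  · filter_upwards [H.2.1] with t ht
    exact mul_nonneg ht.1 ENNReal.toReal_nonneg
  · exact (integrable_mul H.1 H.2.1 hgi).1

lemma dual {C : ℝ → ℝ → ℝ} (h : IsCopula C) {f : ℝ → ℝ} (hi : Integrable f lam) :
    ∃ g : ℝ → ℝ, Integrable g lam ∧ ∀ φ σ, RPair C φ σ →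
      ∫ t, φ t * g t ∂lam = ∫ t, σ t * f t ∂lam := by
  set f' := hi.1.mk f with hf'
  have hm : Measurable f' := hi.1.stronglyMeasurable_mk.measurable
  have he : f =ᵐ[lam] f' := hi.1.ae_eq_mk
  have hi' : Integrable f' lam := hi.congr he
  obtain ⟨g, hg, hG⟩ := dual_nonneg h (f := fun t => max (f' t) 0) (hm.max measurable_const)
    (fun t => le_max_right _ _) hi'.pos_part
  obtain ⟨k, hk, hK⟩ := dual_nonneg h (f := fun t => max (-f' t) 0) (hm.neg.max measurable_const)
    (fun t => le_max_right _ _) hi'.neg_part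
  refine ⟨fun t => g t - k t, hg.sub hk, ?_⟩
  intro φ σ H
  simp_rw [mul_sub]
  rw [integral_sub (integrable_mul H.1 H.2.1 hg) (integrable_mul H.1 H.2.1 hk), hG _ _ H, hK _ _ H,
    ← integral_sub (integrable_mul H.2.2.1 H.2.2.2.1 hi'.pos_part)
      (integrable_mul H.2.2.1 H.2.2.2.1 hi'.neg_part)]
  apply integral_congr_ae
  filter_upwards [he] with t ht
  rw [ht, ← mul_sub, max_zero_sub_max_neg_zero_eq_self]

lemma rpair_ind {C : ℝ → ℝ → ℝ} (h : IsCopula C) {x : ℝ} (hx : x ∈ Icc (0:ℝ) 1) :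
    RPair C ((Iic x).indicator 1) (deriv (fun w => C x w)) := by
  refine ⟨measurable_one.indicator measurableSet_Iic, ?_, measurable_deriv _,
    (ml2 h hx).deriv_ae, ?_⟩
  · refine ae_of_all _ fun t => ?_
    by_cases ht : t ∈ Iic x
    · simp [indicator_of_mem ht]
    · simp [indicator_of_notMem ht]
  · intro a ha
    rw [(ml2 h hx).integral (by simp) ha, (h.1 x hx).1, sub_zero]
    have e : ∀ t, (Iic x).indicator (1 : ℝ → ℝ) t * deriv (fun s => C s a) t =
        (Iic x).indicator (deriv (fun s => C s a)) t := by
      intro t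
      by_cases ht : t ∈ Iic x
      · simp [indicator_of_mem ht]
      · simp [indicator_of_notMem ht]
    simp_rw [e]
    rw [integral_indicator measurableSet_Iic, lam_Iic hx, ← intervalIntegral.integral_of_le hx.1,
      (ml1 h ha).integral (by simp) hx, (h.2.1 a ha).1, sub_zero]

lemma rpair_prod {C₁ C₂ : ℝ → ℝ → ℝ} (h₁ : IsCopula C₁) (h₂ : IsCopula C₂) {u : ℝ}
    (hu : u ∈ Icc (0:ℝ) 1) :
    RPair C₂ (deriv (fun s => C₁ u s)) (deriv (fun v => MarkovProduct C₁ C₂ u v)) := by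
  have hm := ml2 (prod_copula h₁ h₂) hu
  refine ⟨measurable_deriv _, (ml2 h₁ hu).deriv_ae, measurable_deriv _, hm.deriv_ae, ?_⟩
  intro a ha
  rw [hm.integral (by simp) ha, ((prod_copula h₁ h₂).1 u hu).1, sub_zero, prod_eq]

lemma op_ae {C : ℝ → ℝ → ℝ} (h : IsCopula C) {f g : ℝ → ℝ} (hg : Integrable g lam)
    (hG : ∀ φ σ, RPair C φ σ → ∫ t, φ t * g t ∂lam = ∫ t, σ t * f t ∂lam) :
    MarkovOp C f =ᵐ[lam] g := by
  have hgi : IntervalIntegrable g volume 0 1 :=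
    (intervalIntegrable_iff_integrableOn_Ioc_of_le zero_le_one).2 hg
  filter_upwards [ae_restrict_of_ae hgi.ae_hasDerivAt_integral, ae_Ioo] with t h1 h2
  rw [uIcc_of_le zero_le_one] at h1
  have h3 := h1 (Ioo_subset_Icc_self h2) 0 (by simp)
  rw [← h3.deriv]
  apply EventuallyEq.deriv_eq
  filter_upwards [Icc_mem_nhds h2.1 h2.2] with x hx
  rw [intI, ← hG _ _ (rpair_ind h hx)]
  have e : ∀ t, (Iic x).indicator (1 : ℝ → ℝ) t * g t = (Iic x).indicator g t := by
    intro t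
    by_cases ht : t ∈ Iic x
    · simp [indicator_of_mem ht]
    · simp [indicator_of_notMem ht]
  simp_rw [e]
  rw [integral_indicator measurableSet_Iic, lam_Iic hx, ← intervalIntegral.integral_of_le hx.1]

end CopAux

theorem markovProduct_isCopula_and_op_comp (C₁ C₂ : ℝ → ℝ → ℝ)
    (h₁ : IsCopula C₁) (h₂ : IsCopula C₂) :
    IsCopula (MarkovProduct C₁ C₂) ∧
    ∀ f : ℝ → ℝ, IntegrableOn f (Icc (0:ℝ) 1) →
      MarkovOp (MarkovProduct C₁ C₂) f
        =ᵐ[volume.restrict (Icc (0:ℝ) 1)] MarkovOp C₁ (MarkovOp C₂ f) := by 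
  refine ⟨CopAux.prod_copula h₁ h₂, ?_⟩
  intro f hf
  have hf' : Integrable f CopAux.lam := hf.mono_set Ioc_subset_Icc_self
  obtain ⟨g, hg, hG⟩ := CopAux.dual h₂ hf'
  have hop := CopAux.op_ae h₂ hg hG
  rw [← Measure.restrict_congr_set (Ioc_ae_eq_Icc (μ := volume) (a := (0:ℝ)) (b := 1))]
  filter_upwards [CopAux.ae_Ioo] with t ht
  apply EventuallyEq.deriv_eq
  filter_upwards [Icc_mem_nhds ht.1 ht.2] with u hu
  rw [CopAux.intI, CopAux.intI, ← hG _ _ (CopAux.rpair_prod h₁ h₂ hu)]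
  apply integral_congr_ae
  filter_upwards [hop] with s hs
  rw [hs]
end
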